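/- Let p be a prime. Then the group C₄ × C_p × C_p is a DCI-group if and only if p ≠ 2. -/

import Mathlib

open scoped Pointwise

noncomputable section

namespace Paper

/-- The element `∑_{x ∈ X} x` of the integer group ring `ℤG`. -/
def sumElems {G : Type*} [Group G] [Finite G] (X : Set G) : MonoidAlgebra ℤ G :=
  ∑ x ∈ X.toFinite.toFinset, MonoidAlgebra.single x (1 : ℤ)

/-- A Schur ring (S-ring) over a finite group `G`, described by the partition of `G`
into its basic sets: the partition contains `{1}`, is closed under taking inverses,
and its `ℤ`-span inside the group ring `ℤG` is closed under multiplication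
(hence is a subring of `ℤG`). -/
structure SRing (G : Type*) [Group G] [Finite G] where
  basic : Set (Set G)
  nonempty : ∀ X ∈ basic, X.Nonempty
  cover : ∀ g : G, ∃! X, X ∈ basic ∧ g ∈ X
  one_mem : ({1} : Set G) ∈ basic
  inv_mem : ∀ X ∈ basic, X⁻¹ ∈ basic
  mul_mem : ∀ a b : MonoidAlgebra ℤ G,
    a ∈ Submodule.span ℤ (sumElems '' basic) →
    b ∈ Submodule.span ℤ (sumElems '' basic) →
    a * b ∈ Submodule.span ℤ (sumElems '' basic)

namespace SRing

/-- The `ℤ`-module underlying an S-ring. -/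
def span {G : Type*} [Group G] [Finite G] (A : SRing G) :
    Submodule ℤ (MonoidAlgebra ℤ G) :=
  Submodule.span ℤ (sumElems '' A.basic)

/-- A set `X ⊆ G` is an `𝒜`-set if `∑_{x ∈ X} x ∈ 𝒜`. -/
def IsASet {G : Type*} [Group G] [Finite G] (A : SRing G) (X : Set G) : Prop :=
  sumElems X ∈ A.span

/-- A subgroup which is an `𝒜`-set is an `𝒜`-subgroup. -/
def IsASubgroup {G : Type*} [Group G] [Finite G] (A : SRing G) (H : Subgroup G) : Prop :=
  A.IsASet (H : Set G)

end SRing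

/-- The arc set `R(X) = {(g, xg) : x ∈ X, g ∈ G}` of the Cayley digraph `Cay(G, X)`. -/
def Rel {G : Type*} [Group G] (X : Set G) : Set (G × G) := {p | p.2 * p.1⁻¹ ∈ X}

/-- `f : G ≃ G'` is an isomorphism from the S-ring `A` over `G` to the S-ring `B`
over `G'` if `{R(X)^f : X ∈ 𝒮(A)} = {R(Y) : Y ∈ 𝒮(B)}`. -/
def IsSRingIso {G G' : Type*} [Group G] [Finite G] [Group G'] [Finite G']
    (A : SRing G) (B : SRing G') (f : G ≃ G') : Prop :=
  (fun X => Prod.map f f '' Rel X) '' A.basic = Rel '' B.basic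

/-- The automorphism group `Aut(𝒜)` of an S-ring, as a set of permutations of `G`. -/
def SRing.autSet {G : Type*} [Group G] [Finite G] (A : SRing G) : Set (Equiv.Perm G) :=
  {f | ∀ X ∈ A.basic, Prod.map f f '' Rel X = Rel X}

/-- The set `Iso(𝒜)` of isomorphisms from `𝒜` onto S-rings over the same group `G`. -/
def SRing.isoSet {G : Type*} [Group G] [Finite G] (A : SRing G) : Set (Equiv.Perm G) :=
  {f | ∃ B : SRing G, IsSRingIso A B f}

/-- `Aut(G)` as a set of permutations of `G`. -/
def autPerm (G : Type*) [Group G] : Set (Equiv.Perm G) :=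
  Set.range fun φ : G ≃* G => (φ.toEquiv : Equiv.Perm G)

/-- A CI-S-ring: `Aut(𝒜)·Aut(G) = Iso(𝒜)`. -/
def SRing.IsCI {G : Type*} [Group G] [Finite G] (A : SRing G) : Prop :=
  A.autSet * autPerm G = A.isoSet

/-- The orbits on `G` of a set of automorphisms of `G`. -/
def setOrbits {G : Type*} [Group G] (Δ : Set (MulAut G)) : Set (Set G) :=
  Set.range fun g : G => (fun φ : MulAut G => φ g) '' Δ

/-- An S-ring is cyclotomic if its basic sets are exactly the orbits of some
subgroup `K ≤ Aut(G)`. -/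
def SRing.IsCyclotomic {G : Type*} [Group G] [Finite G] (A : SRing G) : Prop :=
  ∃ K : Subgroup (MulAut G), A.basic = setOrbits (K : Set (MulAut G))

/-- `Aut_G(𝒜) = Aut(𝒜) ∩ Aut(G)`, as a set of automorphisms of `G`. -/
def SRing.autGSet {G : Type*} [Group G] [Finite G] (A : SRing G) : Set (MulAut G) :=
  {φ | (φ.toEquiv : Equiv.Perm G) ∈ A.autSet}

/-- A (cyclotomic) S-ring is Cayley minimal if `Aut_G(𝒜)` is the only subgroup of
`Aut(G)` whose orbits on `G` coincide with those of `Aut_G(𝒜)`. -/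
def SRing.IsCayleyMinimal {G : Type*} [Group G] [Finite G] (A : SRing G) : Prop :=
  ∀ K : Subgroup (MulAut G),
    setOrbits (K : Set (MulAut G)) = setOrbits A.autGSet →
    (K : Set (MulAut G)) = A.autGSet

/-- `rad(X) = {g ∈ G : gX = Xg = X}`. -/
def rad {G : Type*} [Group G] (X : Set G) : Set G := {g | {g} * X = X ∧ X * {g} = X}

/-- The class `𝓔_c` of finite abelian groups all of whose Sylow subgroups are
elementary abelian or isomorphic to `C₄`. -/
def InEc (G : Type*) [CommGroup G] [Finite G] : Prop :=
  ∀ p : ℕ, p.Prime → ∀ P : Sylow p G,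
    (∀ x : ↥(P : Subgroup G), x ^ p = 1) ∨
    Nonempty (↥(P : Subgroup G) ≃* Multiplicative (ZMod 4))

/-- A finite group `G` is a `DCI`-group if any two Cayley digraphs over `G` that are
isomorphic as digraphs are Cayley isomorphic. -/
def IsDCIGroup (G : Type*) [Group G] : Prop :=
  ∀ S T : Set G,
    (∃ f : G ≃ G, ∀ g h : G, h * g⁻¹ ∈ S ↔ f h * (f g)⁻¹ ∈ T) →
    ∃ φ : G ≃* G, ⇑φ '' S = T

/-- The subgroup `G_r ≤ Sym(G)` of right translations of `G`. -/
def rightTranslations (G : Type*) [Group G] : Subgroup (Equiv.Perm G) where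
  carrier := Set.range fun g : G => Equiv.mulRight g
  one_mem' := ⟨1, by ext x; simp⟩
  mul_mem' := by
    rintro _ _ ⟨a, rfl⟩ ⟨b, rfl⟩
    exact ⟨b * a, by ext x; simp [mul_assoc]⟩
  inv_mem' := by
    rintro _ ⟨a, rfl⟩
    exact ⟨a⁻¹, by ext x; simp⟩

/-- The basic sets of the S-ring `V(K, G)`: the orbits of the stabilizer `K_e`
of the identity on `G`. -/
def VBasic {G : Type*} [Group G] (K : Subgroup (Equiv.Perm G)) : Set (Set G) :=
  Set.range fun g : G => MulAction.orbit (MulAction.stabilizer K (1 : G)) g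

/-- A subgroup `R ≤ Sym(G)` is regular if for all `g, h ∈ G` there is a
unique `r ∈ R` with `r(g) = h`. -/
def IsRegularSubgroup {G : Type*} [Group G] (R : Subgroup (Equiv.Perm G)) : Prop :=
  ∀ g h : G, ∃! r : R, (r : Equiv.Perm G) g = h

/-- `K ∈ Sup(G_r)`. -/
def InSup {G : Type*} [Group G] (K : Subgroup (Equiv.Perm G)) : Prop :=
  rightTranslations G ≤ K

/-- `K ∈ Sup₂(G_r)`, i.e. `K ≥ G_r` and `K = K^{(2)} = Aut(V(K,G))`. -/
def InSup2 {G : Type*} [Group G] [Finite G] (K : Subgroup (Equiv.Perm G)) : Prop :=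
  InSup K ∧
    (K : Set (Equiv.Perm G)) =
      {f : Equiv.Perm G | ∀ X ∈ VBasic K, Prod.map (⇑f) (⇑f) '' Rel X = Rel X}

/-- `K₁ ⪯_G K₂`: `K₁ ≤ K₂` and every regular subgroup of `K₂` isomorphic to `G`
is conjugate in `K₂` to a subgroup of `K₁`. -/
def GComplete {G : Type*} [Group G] (K₁ K₂ : Subgroup (Equiv.Perm G)) : Prop :=
  K₁ ≤ K₂ ∧ ∀ R : Subgroup (Equiv.Perm G), R ≤ K₂ → IsRegularSubgroup R →
    Nonempty (↥R ≃* G) → ∃ k ∈ K₂, ∀ r ∈ R, k * r * k⁻¹ ∈ K₁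

/-- `K ∈ Sup₂^min(G_r)`: a minimal element of `Sup₂(G_r)` with respect to `⪯_G`. -/
def InSup2Min {G : Type*} [Group G] [Finite G] (K : Subgroup (Equiv.Perm G)) : Prop :=
  InSup2 K ∧ ∀ K' : Subgroup (Equiv.Perm G), InSup2 K' → GComplete K' K → K' = K

/-- The basic sets of the restriction `𝒜_U` of `𝒜` to an `𝒜`-subgroup `U`:
the basic sets of `𝒜` contained in `U`, viewed inside `U`. -/
def restrictBasic {G : Type*} [Group G] [Finite G] (A : SRing G) (U : Subgroup G) :
    Set (Set ↥U) :=
  {Y : Set ↥U | Subtype.val '' Y ∈ A.basic}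

/-- The basic sets of the quotient S-ring `𝒜_{G/L}`: the images of the basic
sets of `𝒜` under the canonical epimorphism `G → G/L`. -/
def quotBasic {G : Type*} [CommGroup G] [Finite G] (A : SRing G) (L : Subgroup G) :
    Set (Set (G ⧸ L)) :=
  (fun X => QuotientGroup.mk '' X) '' A.basic

/-- The basic sets of the S-ring `𝒜_S` on the section `S = U/L`: the images under
the canonical epimorphism `U → U/L` of the basic sets of `𝒜` contained in `U`. -/
def secBasic {G : Type*} [CommGroup G] [Finite G] (A : SRing G) (U L : Subgroup G) :
    Set (Set (↥U ⧸ L.subgroupOf U)) :=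
  {Z | ∃ X ∈ A.basic, X ⊆ (U : Set G) ∧
    Z = QuotientGroup.mk '' (Subtype.val ⁻¹' X : Set ↥U)}

/-- The set of bijections of `H ⧸ N` induced by members of `Δ ⊆ Sym(H)`
permuting the `N`-cosets. -/
def inducedOnQuot {H : Type*} [CommGroup H] (N : Subgroup H) (Δ : Set (Equiv.Perm H)) :
    Set (Equiv.Perm (H ⧸ N)) :=
  {σ | ∃ f ∈ Δ, ∀ x : H, σ (QuotientGroup.mk x) = QuotientGroup.mk (f x)}

/-- The canonical (injective) homomorphism `U/L → G/L` for `L ≤ U ≤ G`. -/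
def secIncl {G : Type*} [CommGroup G] (U L : Subgroup G) :
    (↥U ⧸ L.subgroupOf U) →* G ⧸ L :=
  QuotientGroup.map (L.subgroupOf U) L U.subtype (fun _ hx => hx)

/-- The set of bijections of the section `S = U/L` induced by members of
`Δ ⊆ Sym(G/L)` preserving `S` (i.e. permuting the `L`-cosets contained in `U`). -/
def inducedOnSec {G : Type*} [CommGroup G] (U L : Subgroup G)
    (Δ : Set (Equiv.Perm (G ⧸ L))) : Set (Equiv.Perm (↥U ⧸ L.subgroupOf U)) :=
  {σ | ∃ φ ∈ Δ, ∀ x : ↥U,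
    φ (QuotientGroup.mk (x : G) : G ⧸ L) = secIncl U L (σ (QuotientGroup.mk x))}

/-- The basic sets of the S-ring `(ℤL ⊗ 𝒜_V) ≀_{(V×L)/V} ℤ(U/V)` over `U`,
where `Lu, V ≤ U` and `𝒜_V` is the restriction of `𝒜_U` to `V`. -/
def tensorWreathBasic {U : Type*} [CommGroup U] [Finite U] (AU : SRing U)
    (Lu V : Subgroup U) : Set (Set U) :=
  {Z | (∃ l ∈ Lu, ∃ X ∈ AU.basic, X ⊆ (V : Set U) ∧ Z = l • X) ∨
       (∃ u : U, u ∉ Lu ⊔ V ∧ Z = u • (V : Set U))}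

/-- Condition (CA): `𝒜_S = ℤS`. -/
def CondCA {G : Type*} [CommGroup G] [Finite G] (A : SRing G) (U L : Subgroup G) : Prop :=
  ∀ AS : SRing (↥U ⧸ L.subgroupOf U), AS.basic = secBasic A U L →
    AS.basic = Set.range fun s => ({s} : Set (↥U ⧸ L.subgroupOf U))

/-- Condition (CA'): `𝒜_U` or `𝒜_{G/L}` is cyclotomic and `𝒜_S` is Cayley minimal. -/
def CondCA' {G : Type*} [CommGroup G] [Finite G] (A : SRing G) (U L : Subgroup G) : Prop :=
  ((∀ AU : SRing ↥U, AU.basic = restrictBasic A U → AU.IsCyclotomic) ∨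
   (∀ AQ : SRing (G ⧸ L), AQ.basic = quotBasic A L → AQ.IsCyclotomic)) ∧
  (∀ AS : SRing (↥U ⧸ L.subgroupOf U), AS.basic = secBasic A U L → AS.IsCayleyMinimal)

/-- Condition (CA''): `U ≅ C_{4p}`, `L ≅ C₂` and
`𝒜_U = (ℤL ⊗ 𝒜_V) ≀_{(V×L)/V} ℤ(U/V)` for an `𝒜_U`-subgroup `V` of order `p`. -/
def CondCA'' {G : Type*} [CommGroup G] [Finite G] (p : ℕ) (A : SRing G)
    (U L : Subgroup G) : Prop :=
  Nat.card ↥U = 4 * p ∧ IsCyclic ↥U ∧ Nat.card ↥L = 2 ∧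
  ∀ AU : SRing ↥U, AU.basic = restrictBasic A U →
    ∃ V : Subgroup ↥U, AU.IsASubgroup V ∧ Nat.card ↥V = p ∧
      AU.basic = tensorWreathBasic AU (L.subgroupOf U) V

/-- `𝒜 = 𝒜_{G₁} ⊗ 𝒜_{G₂}` for `G = G₁ × G₂` (internally). -/
def IsTensorDecomp {G : Type*} [CommGroup G] [Finite G] (A : SRing G)
    (G₁ G₂ : Subgroup G) : Prop :=
  A.IsASubgroup G₁ ∧ A.IsASubgroup G₂ ∧ G₁ ⊓ G₂ = ⊥ ∧ G₁ ⊔ G₂ = ⊤ ∧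
  A.basic = {Z | ∃ X ∈ A.basic, ∃ Y ∈ A.basic,
    X ⊆ (G₁ : Set G) ∧ Y ⊆ (G₂ : Set G) ∧ Z = X * Y}

/-- `𝒜` is the tensor product of two S-rings over proper nontrivial subgroups of `G`. -/
def TensorConclusion {G : Type*} [CommGroup G] [Finite G] (A : SRing G) : Prop :=
  ∃ G₁ G₂ : Subgroup G, G₁ ≠ ⊥ ∧ G₁ ≠ ⊤ ∧ G₂ ≠ ⊥ ∧ G₂ ≠ ⊤ ∧ IsTensorDecomp A G₁ G₂

/-- `𝒜` is a nontrivial `S = U/L`-wreath product satisfying one of the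
conditions (CA), (CA'), (CA''). -/
def WreathConclusion {G : Type*} [CommGroup G] [Finite G] (p : ℕ) (A : SRing G) : Prop :=
  ∃ U L : Subgroup G, L ≤ U ∧ A.IsASubgroup U ∧ A.IsASubgroup L ∧ L ≠ ⊥ ∧ U ≠ ⊤ ∧
    (∀ X ∈ A.basic, ¬ X ⊆ (U : Set G) → (L : Set G) ⊆ rad X) ∧
    (CondCA A U L ∨ CondCA' A U L ∨ CondCA'' p A U L)

theorem eq_of_add_period {p : ℕ} [Fact p.Prime] {C : Type*} {F : ZMod p → C} {c : ZMod p}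
    (hc : c ≠ 0) (h : ∀ l, F (l + c) = F l) (l m : ZMod p) : F l = F m := by
  have key : ∀ n : ℕ, ∀ l, F (l + n * c) = F l := by
    intro n
    induction n with
    | zero => simp
    | succ n ih =>
      intro l
      have := h (l + n * c)
      rw [← ih l, ← this]
      congr 1
      push_cast
      ring
  have := key ((l - m) / c).val m
  rw [ZMod.natCast_zmod_val, div_mul_cancel₀ _ hc] at this
  simpa using this

theorem four_ne_zero_zmod {p : ℕ} [hp : Fact p.Prime] (hp2 : p ≠ 2) : (4 : ZMod p) ≠ 0 := by
  intro h
  have h' : ((4 : ℕ) : ZMod p) = 0 := by exact_mod_cast h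
  rw [ZMod.natCast_eq_zero_iff] at h'
  have : p ∣ 2 ^ 2 := by simpa using h'
  exact hp2 ((Nat.prime_dvd_prime_iff_eq hp.out Nat.prime_two).1 (hp.out.dvd_of_dvd_pow this))

/-- A function of two variables invariant under a cycle of four shearing maps, the first of which
is not a translation, depends only on the second variable outside its zero fibre. -/
theorem const_of_shear_invariant {p : ℕ} [Fact p.Prime] (hp2 : p ≠ 2) {C : Type*}
    {F : ZMod p → ZMod p → C} {h : ZMod 4 → ZMod p → ZMod p} {μ : ZMod 4 → ZMod p}
    (inv : ∀ k l m m', F (l + h (k + 1) m' - h k m) (m' - m + μ (k + 1) - μ k) = F l (m' - m))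
    (hne : ∃ x y, h 0 x ≠ h 0 y) {m : ZMod p} (hm : m ≠ 0) (l l' : ZMod p) :
    F l m = F l' m := by
  have h4 := four_ne_zero_zmod hp2
  by_contra hcon
  have rigid : ∀ n c, (∃ l l', F l n ≠ F l' n) → (∀ l, F (l + c) n = F l n) → c = 0 := by
    rintro n c ⟨a, b, hab⟩ hc
    by_contra hc0
    exact hab (eq_of_add_period (F := fun l => F l n) hc0 hc a b)
  by_cases hν : ∀ k, μ (k + 1) = μ k
  · have step : ∀ k x, h (k + 1) (x + m) = h k x := by
      intro k x
      have := rigid m (h (k + 1) (x + m) - h k x) ⟨l, l', hcon⟩ (by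
        intro l
        have := inv k l x (x + m)
        rw [hν k] at this
        simpa [add_sub_assoc] using this)
      exact sub_eq_zero.1 this
    have per : ∀ x, h 0 (x + 4 * m) = h 0 x := by
      intro x
      have a := step 3 (x + 3 * m)
      have b := step 2 (x + 2 * m)
      have c := step 1 (x + m)
      have d := step 0 x
      have e : (3 : ZMod 4) + 1 = 0 := by decide
      have e2 : (2 : ZMod 4) + 1 = 3 := by decide
      have e1 : (1 : ZMod 4) + 1 = 2 := by decide
      rw [e] at a; rw [e2] at b; rw [e1] at c; rw [zero_add] at d
      have i1 : x + 4 * m = x + 3 * m + m := by ring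
      have i2 : x + 3 * m = x + 2 * m + m := by ring
      have i3 : x + 2 * m = x + m + m := by ring
      rw [i1, a, i2, b, i3, c, d]
    obtain ⟨x, y, hxy⟩ := hne
    exact hxy (eq_of_add_period (F := h 0) (mul_ne_zero h4 hm) per x y)
  · push Not at hν
    obtain ⟨k₀, hk₀⟩ := hν
    have all : ∀ n, ∃ l l', F l n ≠ F l' n := by
      have hstep : ∀ n, (∃ l l', F l n ≠ F l' n) ↔
          ∃ l l', F l (n + (μ (k₀ + 1) - μ k₀)) ≠ F l' (n + (μ (k₀ + 1) - μ k₀)) := by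
        intro n
        have e : ∀ l, F (l + (h (k₀ + 1) n - h k₀ 0)) (n + (μ (k₀ + 1) - μ k₀)) = F l n := by
          intro l
          have := inv k₀ l 0 n
          simpa [add_sub_assoc] using this
        constructor
        · rintro ⟨a, b, hab⟩
          refine ⟨a + (h (k₀ + 1) n - h k₀ 0), b + (h (k₀ + 1) n - h k₀ 0), ?_⟩
          rw [e a, e b]
          exact hab
        · rintro ⟨a, b, hab⟩
          refine ⟨a - (h (k₀ + 1) n - h k₀ 0), b - (h (k₀ + 1) n - h k₀ 0), ?_⟩
          rw [← e, ← e]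
          simpa using hab
      intro n
      have := eq_of_add_period (F := fun n => ∃ l l', F l n ≠ F l' n) (sub_ne_zero.2 hk₀)
        (fun n => propext (hstep n).symm) n m
      rw [this]
      exact ⟨l, l', hcon⟩
    have indep : ∀ k n x x', h (k + 1) (x + n) - h k x = h (k + 1) (x' + n) - h k x' := by
      intro k n x x'
      refine sub_eq_zero.1 (rigid (n + (μ (k + 1) - μ k)) _ (all _) ?_)
      intro a
      have e1 := inv k (a - (h (k + 1) (x' + n) - h k x')) x (x + n)
      have e2 := inv k (a - (h (k + 1) (x' + n) - h k x')) x' (x' + n)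
      rw [add_sub_cancel_left] at e1 e2
      have := e1.trans e2.symm
      convert this using 2 <;> ring
    have slope : ∀ k, ∃ η, (∀ x, h k x = h k 0 + η * x) ∧ ∀ x, h (k + 1) x = h (k + 1) 0 + η * x := by
      intro k
      have e : ∀ x y, h k (x + 1) - h k x = h (k + 1) (y + 1) - h (k + 1) y := by
        intro x y
        have := indep k (y - x) (x + 1) x
        have e1 : x + 1 + (y - x) = y + 1 := by ring
        have e2 : x + (y - x) = y := by ring
        rw [e1, e2] at this
        linear_combination -this
      have lin : ∀ (g : ZMod p → ZMod p) (η : ZMod p), (∀ x, g (x + 1) - g x = η) →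
          ∀ x, g x = g 0 + η * x := by
        intro g η hg x
        have : ∀ n : ℕ, g n = g 0 + η * n := by
          intro n
          induction n with
          | zero => simp
          | succ n ih =>
            have := hg n
            push_cast
            linear_combination this + ih
        have := this x.val
        rwa [ZMod.natCast_zmod_val] at this
      refine ⟨h k (0 + 1) - h k 0, lin _ _ ?_, lin _ _ ?_⟩
      · intro x
        rw [e x 0, e 0 0]
      · intro y
        rw [← e 0 y]
    obtain ⟨η, hη, hη1⟩ := slope 0
    have all_slope : ∀ k x, h k x = h k 0 + η * x := by
      have next : ∀ k, (∀ x, h k x = h k 0 + η * x) → ∀ x, h (k + 1) x = h (k + 1) 0 + η * x := by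
        intro k hk
        obtain ⟨η', h1, h2⟩ := slope k
        have : η' = η := by
          have a := h1 1
          have b := hk 1
          linear_combination b - a
        rw [← this]; exact h2
      have s1 := next 0 hη
      have s2 := next _ s1
      have s3 := next _ s2
      intro k
      have : k = 0 ∨ k = 0 + 1 ∨ k = 0 + 1 + 1 ∨ k = 0 + 1 + 1 + 1 := by
        revert k; decide
      rcases this with rfl | rfl | rfl | rfl
      exacts [hη, s1, s2, s3]
    have hη0 : η ≠ 0 := by
      rintro rfl
      obtain ⟨x, y, hxy⟩ := hne
      apply hxy
      rw [hη x, hη y]; simp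
    have T : ∀ k a n, F (a + η * n + (h (k + 1) 0 - h k 0)) (n + (μ (k + 1) - μ k)) = F a n := by
      intro k a n
      have := inv k a 0 n
      rw [all_slope (k + 1) n] at this
      simp only [sub_zero] at this
      rw [← this]
      congr 1 <;> ring
    have eqν : ∀ j k, μ (j + 1) - μ j = μ (k + 1) - μ k := by
      intro j k
      have : η * (μ (j + 1) - μ j) - η * (μ (k + 1) - μ k) = 0 := by
        refine rigid (0 + (μ (j + 1) - μ j) + (μ (k + 1) - μ k)) _ (all _) ?_
        intro a
        set cj := h (j + 1) 0 - h j 0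
        set ck := h (k + 1) 0 - h k 0
        set νj := μ (j + 1) - μ j
        set νk := μ (k + 1) - μ k
        set a' := a - η * νk - cj - ck
        have e1 := T j a' 0
        have e2 := T k (a' + η * 0 + cj) (0 + νj)
        have e3 := T k a' 0
        have e4 := T j (a' + η * 0 + ck) (0 + νk)
        have e5 := (e2.trans e1).trans ((e4.trans e3).symm)
        rw [show (0 : ZMod p) + νk + νj = 0 + νj + νk by ring] at e5
        convert e5 using 2 <;> simp only [a'] <;> ring
      have := mul_left_cancel₀ hη0 (sub_eq_zero.1 this)
      exact this
    have sum : (4 : ZMod p) * (μ (k₀ + 1) - μ k₀) = 0 := by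
      have a := eqν k₀ 0
      have b := eqν k₀ 1
      have c := eqν k₀ 2
      have d := eqν k₀ 3
      have e : (3 : ZMod 4) + 1 = 0 := by decide
      have e2 : (2 : ZMod 4) + 1 = 3 := by decide
      have e1 : (1 : ZMod 4) + 1 = 2 := by decide
      rw [e] at d; rw [e2] at c; rw [e1] at b; rw [zero_add] at a
      linear_combination a + b + c + d
    rcases mul_eq_zero.1 sum with h | h
    · exact h4 h
    · exact hk₀ (sub_eq_zero.1 h)

/-- The determinant pairing on the plane. -/
def det2 {p : ℕ} (a b : ZMod p × ZMod p) : ZMod p := a.1 * b.2 - a.2 * b.1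

theorem det2_add {p : ℕ} (a b c : ZMod p × ZMod p) : det2 a (b + c) = det2 a b + det2 a c := by
  simp only [det2, Prod.fst_add, Prod.snd_add]; ring

theorem det2_sub {p : ℕ} (a b c : ZMod p × ZMod p) : det2 a (b - c) = det2 a b - det2 a c := by
  simp only [det2, Prod.fst_sub, Prod.snd_sub]; ring

theorem det2_smul {p : ℕ} (a b : ZMod p × ZMod p) (t : ZMod p) :
    det2 a (t • b) = t * det2 a b := by
  simp only [det2, Prod.smul_fst, Prod.smul_snd, smul_eq_mul]; ring

theorem smul_det2 {p : ℕ} (a b : ZMod p × ZMod p) (t : ZMod p) :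
    det2 (t • a) b = t * det2 a b := by
  simp only [det2, Prod.smul_fst, Prod.smul_snd, smul_eq_mul]; ring

@[simp] theorem det2_self {p : ℕ} (a : ZMod p × ZMod p) : det2 a a = 0 := by
  simp only [det2]; ring

@[simp] theorem det2_zero {p : ℕ} (a : ZMod p × ZMod p) : det2 a 0 = 0 := by
  simp [det2]

theorem exists_det2_eq_one {p : ℕ} [Fact p.Prime] {a : ZMod p × ZMod p} (ha : a ≠ 0) :
    ∃ e, det2 a e = 1 := by
  by_cases h : a.1 = 0
  · have h2 : a.2 ≠ 0 := fun h2 => ha (Prod.ext h h2)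
    exact ⟨(-a.2⁻¹, 0), by simp [det2, h2]⟩
  · exact ⟨(0, a.1⁻¹), by simp [det2, h]⟩

theorem det2_coords {p : ℕ} {a e : ZMod p × ZMod p} (he : det2 a e = 1) (x : ZMod p × ZMod p) :
    x = (-det2 e x) • a + det2 a x • e := by
  simp only [det2] at *
  ext
  · simp only [Prod.fst_add, Prod.smul_fst, smul_eq_mul]
    linear_combination -x.1 * he
  · simp only [Prod.snd_add, Prod.smul_snd, smul_eq_mul]
    linear_combination -x.2 * he

theorem eq_smul_of_det2_eq_zero {p : ℕ} [Fact p.Prime] {a x : ZMod p × ZMod p} (ha : a ≠ 0)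
    (h : det2 a x = 0) : ∃ t : ZMod p, x = t • a := by
  obtain ⟨e, he⟩ := exists_det2_eq_one ha
  exact ⟨-det2 e x, by simpa [h] using det2_coords he x⟩

theorem eq_smul_period {p : ℕ} [Fact p.Prime] {C : Type*} {F : ZMod p × ZMod p → C}
    {a : ZMod p × ZMod p} (h : ∀ x, F (x + a) = F x) (x : ZMod p × ZMod p) (t : ZMod p) :
    F (x + t • a) = F x := by
  have := eq_of_add_period (F := fun t : ZMod p => F (x + t • a)) one_ne_zero
    (fun l => by rw [add_smul, one_smul, ← add_assoc, h]) t 0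
  simpa using this

theorem line_const_of_invariant {p : ℕ} [Fact p.Prime] (hp2 : p ≠ 2) {C : Type*}
    {F : ZMod p × ZMod p → C} {d : ZMod 4 → ZMod p × ZMod p → ZMod p × ZMod p}
    {a : ZMod p × ZMod p} (ha : a ≠ 0) (per : ∀ k x, d k (x + a) = d k x)
    (hdet : ∀ k x y, det2 a (d k x) = det2 a (d k y))
    (inv : ∀ k x y, F (y - x + d (k + 1) y - d k x) = F (y - x))
    (hne : ∃ x y, d 0 x ≠ d 0 y) {u : ZMod p × ZMod p} (hu : det2 a u ≠ 0) (t : ZMod p) :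
    F (u + t • a) = F u := by
  obtain ⟨e, he⟩ := exists_det2_eq_one ha
  have red : ∀ k x, d k x = d k (det2 a x • e) := by
    intro k x
    conv_lhs => rw [det2_coords he x, add_comm]
    exact eq_smul_period (per k) _ _
  have key := const_of_shear_invariant hp2 (F := fun l m => F (l • a + m • e))
    (h := fun k m => -det2 e (d k (m • e))) (μ := fun k => det2 a (d k 0)) (by
      intro k l m m'
      have := inv k (m • e) (l • a + m' • e)
      rw [red (k + 1) (l • a + m' • e)] at this
      simp only [det2_add, det2_smul, det2_self, he, mul_zero, zero_add, mul_one] at this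
      have e1 := det2_coords he (d (k + 1) (m' • e))
      have e2 := det2_coords he (d k (m • e))
      rw [e1, e2, hdet (k + 1) _ 0, hdet k _ 0] at this
      convert this using 2
      · module
      · module) (by
      obtain ⟨x, y, hxy⟩ := hne
      refine ⟨det2 a x, det2 a y, fun h => hxy ?_⟩
      rw [red 0 x, red 0 y, det2_coords he (d 0 (det2 a x • e)),
        det2_coords he (d 0 (det2 a y • e)), hdet 0 (det2 a x • e) 0, hdet 0 (det2 a y • e) 0]
      rw [h]) hu (-det2 e u + t) (-det2 e u)
  have e1 : (-det2 e u + t) • a + det2 a u • e = u + t • a := by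
    conv_rhs => rw [det2_coords he u]
    module
  simp only [e1] at key
  rw [key, ← det2_coords he u]

/-- The subgroup of periods of a function on an additive group. -/
def periods {A C : Type*} [AddCommGroup A] (F : A → C) : AddSubgroup A where
  carrier := {v | ∀ u, F (u + v) = F u}
  zero_mem' u := by simp
  add_mem' {a b} ha hb u := by rw [← add_assoc, hb, ha]
  neg_mem' {a} ha u := by
    have := ha (u + -a)
    rw [← this]
    simp

theorem mem_periods {A C : Type*} [AddCommGroup A] {F : A → C} {v : A} :
    v ∈ periods F ↔ ∀ u, F (u + v) = F u := Iff.rfl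

theorem zmod_smul_mem {p : ℕ} [Fact p.Prime] (H : AddSubgroup (ZMod p × ZMod p)) (t : ZMod p)
    {x : ZMod p × ZMod p} (hx : x ∈ H) : t • x ∈ H := by
  have : t • x = t.val • x := by
    rw [← Nat.cast_smul_eq_nsmul (ZMod p), ZMod.natCast_zmod_val]
  rw [this]
  exact H.nsmul_mem hx _

theorem exists_addEquiv_of_affine {p : ℕ} [Fact p.Prime] (hp2 : p ≠ 2) {C : Type*}
    {χ χ' : (ZMod p × ZMod p) × ZMod 4 → C}
    (f : Equiv.Perm ((ZMod p × ZMod p) × ZMod 4)) (hf : ∀ x y, χ' (f y - f x) = χ (y - x))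
    (hb : ∀ x, (f x).2 = x.2)
    (haff : ∀ i x b, (f (x + b, i)).1 - (f (b, i)).1 = (f (x, i)).1 - (f (0, i)).1) :
    ∃ φ : ((ZMod p × ZMod p) × ZMod 4) ≃+ ((ZMod p × ZMod p) × ZMod 4), ∀ x, χ' (φ x) = χ x := by
  let θ : ZMod 4 → (ZMod p × ZMod p) →+ (ZMod p × ZMod p) := fun i =>
    { toFun := fun x => (f (x, i)).1 - (f (0, i)).1
      map_zero' := by simp
      map_add' := fun x b => by
        have := haff i x b
        rw [← this]
        abel }
  let t : ZMod 4 → ZMod p × ZMod p := fun i => (f (0, i)).1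
  have hfθ : ∀ x i, f (x, i) = (θ i x + t i, i) := by
    intro x i
    refine Prod.ext ?_ (hb _)
    simp [θ, t]
  have hinj : ∀ i, Function.Injective (θ i) := by
    intro i x y hxy
    have : f (x, i) = f (y, i) := by rw [hfθ, hfθ, hxy]
    simpa using f.injective this
  have hbij : ∀ i, Function.Bijective (θ i) := fun i => Finite.injective_iff_bijective.1 (hinj i)
  have E : ∀ i s x u, χ' (θ (i + s) u + (θ (i + s) x - θ i x) + (t (i + s) - t i), s)
      = χ (u, s) := by
    intro i s x u
    have := hf (x, i) (u + x, i + s)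
    rw [hfθ, hfθ] at this
    simp only [Prod.mk_sub_mk, add_sub_cancel_left, add_sub_cancel_right, map_add] at this
    rw [← this]
    congr 2
    abel
  have main : ∀ s u, χ' (θ 0 u, s) = χ (u, s) := by
    intro s
    set T := periods (fun w => χ' (w, s)) with hT
    have hθ : ∀ i x, θ (i + s) x - θ i x ∈ T := by
      intro i x w
      obtain ⟨u, hu⟩ := (hbij (i + s)).2 (w - (t (i + s) - t i))
      have e1 := E i s x u
      have e2 := E i s 0 u
      rw [map_zero, map_zero, sub_zero, add_zero] at e2
      rw [← e2] at e1
      rw [hu] at e1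
      convert e1 using 2 <;> abel
    have hθk : ∀ (k : ℕ) x, θ (k * s) x - θ 0 x ∈ T := by
      intro k x
      induction k with
      | zero => simp
      | succ k ih =>
        have := T.add_mem (hθ (k * s) x) ih
        push_cast
        rw [add_mul, one_mul]
        simpa using this
    have hτ : ∀ (k : ℕ) u, χ' (θ 0 u + (t ((k + 1 : ℕ) * s) - t (k * s)), s) = χ (u, s) := by
      intro k u
      have e := E (k * s) s 0 u
      have h1 := hθk (k + 1) u (θ 0 u + (t ((k + 1 : ℕ) * s) - t (k * s)))
      simp only at h1
      rw [← h1, ← e]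
      push_cast
      rw [add_mul, one_mul, map_zero, map_zero]
      congr 2
      abel
    have hτ0 : ∀ (k : ℕ), (t ((k + 1 : ℕ) * s) - t (k * s)) -
        (t ((0 + 1 : ℕ) * s) - t ((0 : ℕ) * s)) ∈ T := by
      intro k w
      obtain ⟨u, hu⟩ := (hbij 0).2 (w - (t ((0 + 1 : ℕ) * s) - t ((0 : ℕ) * s)))
      have e1 := hτ k u
      have e2 := hτ 0 u
      rw [← e2, hu] at e1
      convert e1 using 2 <;> abel
    have h4 : (4 : ZMod p) • (t ((0 + 1 : ℕ) * s) - t ((0 : ℕ) * s)) ∈ T := by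
      have := T.neg_mem (T.add_mem (T.add_mem (hτ0 1) (hτ0 2)) (hτ0 3))
      have e4 : ((3 + 1 : ℕ) : ZMod 4) = ((0 : ℕ) : ZMod 4) := by decide
      rw [e4] at this
      convert this using 1
      norm_num
      module
    have hmem : t ((0 + 1 : ℕ) * s) - t ((0 : ℕ) * s) ∈ T := by
      have := zmod_smul_mem T (4 : ZMod p)⁻¹ h4
      rwa [smul_smul, inv_mul_cancel₀ (four_ne_zero_zmod hp2), one_smul] at this
    intro u
    rw [← hτ 0 u]
    exact (hmem (θ 0 u)).symm
  refine ⟨(AddEquiv.ofBijective (θ 0) (hbij 0)).prodCongr (AddEquiv.refl _), ?_⟩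
  rintro ⟨u, s⟩
  exact main s u

/-- The group of permutations preserving the Cayley colouring given by `χ`. -/
def colorAut {A C : Type*} [AddCommGroup A] (χ : A → C) : Subgroup (Equiv.Perm A) where
  carrier := {a | ∀ x y, χ (a y - a x) = χ (y - x)}
  one_mem' _ _ := rfl
  mul_mem' {a b} ha hb x y := by
    rw [Equiv.Perm.mul_apply, Equiv.Perm.mul_apply, ha, hb]
  inv_mem' {a} ha x y := by
    have := ha (a⁻¹ x) (a⁻¹ y)
    simpa using this.symm

/-- The permutations fixing every fibre of the second projection. -/
def fiberPerm (A B : Type*) : Subgroup (Equiv.Perm (A × B)) where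
  carrier := {a | ∀ x, (a x).2 = x.2}
  one_mem' _ := rfl
  mul_mem' {a b} ha hb x := by rw [Equiv.Perm.mul_apply, ha, hb]
  inv_mem' {a} ha x := by
    have := ha (a⁻¹ x)
    simpa using this.symm

theorem exists_sylow_in {Γ : Type*} [Group Γ] [Finite Γ] (p : ℕ) [Fact p.Prime]
    {K P : Subgroup Γ} (hPK : P ≤ K) (hP : IsPGroup p P) :
    ∃ S : Subgroup Γ, S ≤ K ∧ P ≤ S ∧ IsPGroup p S ∧
      ∀ Q : Subgroup Γ, Q ≤ K → IsPGroup p Q → ∃ k ∈ K, ∀ q ∈ Q, k * q * k⁻¹ ∈ S := by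
  have lift : ∀ Q : Subgroup Γ, Q ≤ K → IsPGroup p Q → ∃ S : Sylow p K, ∀ q, ∀ h : q ∈ Q,
      ∃ hK : q ∈ K, (⟨q, hK⟩ : K) ∈ S := by
    intro Q hQK hQ
    have : IsPGroup p (Q.subgroupOf K) := hQ.comap_of_injective K.subtype K.subtype_injective
    obtain ⟨S, hS⟩ := this.exists_le_sylow
    exact ⟨S, fun q h => ⟨hQK h, hS (Subgroup.mem_subgroupOf.2 h)⟩⟩
  obtain ⟨S, hS⟩ := lift P hPK hP
  refine ⟨(S : Subgroup K).map K.subtype, ?_, ?_, S.isPGroup'.map _, ?_⟩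
  · rintro _ ⟨x, _, rfl⟩
    exact x.2
  · intro q hq
    obtain ⟨hK, h⟩ := hS q hq
    exact ⟨⟨q, hK⟩, h, rfl⟩
  · intro Q hQK hQ
    obtain ⟨S', hS'⟩ := lift Q hQK hQ
    obtain ⟨k, hk⟩ := MulAction.exists_smul_eq K S' S
    refine ⟨k, k.2, fun q hq => ?_⟩
    obtain ⟨hK, h⟩ := hS' q hq
    refine ⟨k * ⟨q, hK⟩ * k⁻¹, ?_, rfl⟩
    rw [← hk]
    exact Subgroup.smul_mem_pointwise_smul _ (MulAut.conj k) _ h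

theorem exists_central_mod {Γ : Type*} [Group Γ] [Finite Γ] {p : ℕ} [Fact p.Prime]
    (hΓ : IsPGroup p Γ) (N : Subgroup Γ) [N.Normal] (hN : ∃ g, g ∉ N) :
    ∃ z ∉ N, ∀ a, (a * z)⁻¹ * (z * a) ∈ N := by
  obtain ⟨g, hg⟩ := hN
  have : Nontrivial (Γ ⧸ N) := ⟨g, 1, fun h => hg ((QuotientGroup.eq_one_iff g).1 h)⟩
  have := (hΓ.to_quotient N).center_nontrivial
  obtain ⟨⟨z, hz⟩, hz1⟩ := exists_ne (1 : Subgroup.center (Γ ⧸ N))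
  obtain ⟨z, rfl⟩ := QuotientGroup.mk_surjective z
  refine ⟨z, fun h => hz1 (Subtype.ext ((QuotientGroup.eq_one_iff z).2 h)), fun a => ?_⟩
  rw [← QuotientGroup.eq]
  exact Subgroup.mem_center_iff.1 hz a

/-- The displacement of a permutation on a block. -/
def disp {A B : Type*} [AddCommGroup A] (a : Equiv.Perm (A × B)) (i : B) (x : A) : A :=
  (a (x, i)).1 - x

/-- A `p`-group of permutations fixing each block and containing the translations of blocks. -/
structure IsBlockGroup {p : ℕ} (S : Subgroup (Equiv.Perm ((ZMod p × ZMod p) × ZMod 4))) :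
    Prop where
  isPGroup : IsPGroup p S
  le_fiberPerm : S ≤ fiberPerm _ _
  addRight_mem : ∀ v, Equiv.addRight (v, 0) ∈ S

/-- The common periods of the displacements of a group of permutations on a block. -/
def dispPeriods {p : ℕ} (S : Subgroup (Equiv.Perm ((ZMod p × ZMod p) × ZMod 4))) (i : ZMod 4) :
    AddSubgroup (ZMod p × ZMod p) := ⨅ a ∈ S, periods (disp a i)

theorem mem_dispPeriods {p : ℕ} {S : Subgroup (Equiv.Perm ((ZMod p × ZMod p) × ZMod 4))}
    {i : ZMod 4} {v : ZMod p × ZMod p} :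
    v ∈ dispPeriods S i ↔ ∀ a ∈ S, ∀ x, disp a i (x + v) = disp a i x := by
  simp [dispPeriods, AddSubgroup.mem_iInf, mem_periods]

namespace IsBlockGroup

theorem apply_eq {p : ℕ} {S : Subgroup (Equiv.Perm ((ZMod p × ZMod p) × ZMod 4))}
    (hS : IsBlockGroup S) {a : Equiv.Perm ((ZMod p × ZMod p) × ZMod 4)} (ha : a ∈ S)
    (x : ZMod p × ZMod p) (i : ZMod 4) : a (x, i) = (x + disp a i x, i) := by
  refine Prod.ext ?_ (hS.le_fiberPerm ha _)
  simp [disp]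

theorem exists_central {p : ℕ} [hp : Fact p.Prime]
    {S : Subgroup (Equiv.Perm ((ZMod p × ZMod p) × ZMod 4))}
    (hS : IsBlockGroup S) (i j : ZMod 4) :
    ∃ z ∈ S, ∃ v w, (v ≠ 0 ∨ w ≠ 0) ∧ (∀ x, z (x, i) = (x + v, i)) ∧ (∀ x, z (x, j) = (x + w, j)) ∧
      v ∈ dispPeriods S i ∧ w ∈ dispPeriods S j := by
  let N : Subgroup S :=
    { carrier := {a | ∀ x : (ZMod p × ZMod p) × ZMod 4, x.2 = i ∨ x.2 = j → a.1 x = x}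
      one_mem' := fun _ _ => rfl
      mul_mem' := fun {a b} ha hb x hx => by
        change a.1 (b.1 x) = x
        rw [hb x hx, ha x hx]
      inv_mem' := fun {a} ha x hx => by
        change a.1⁻¹ x = x
        rw [Equiv.Perm.inv_eq_iff_eq, ha x hx] }
  have : N.Normal := ⟨fun n hn g x hx => by
    change g.1 (n.1 (g.1⁻¹ x)) = x
    rw [hn (g.1⁻¹ x) (by rw [hS.le_fiberPerm (S.inv_mem g.2) x]; exact hx)]
    simp⟩
  obtain ⟨e, he⟩ := exists_ne (0 : ZMod p × ZMod p)
  obtain ⟨z, hzN, hz⟩ := exists_central_mod hS.isPGroup N ⟨⟨_, hS.addRight_mem e⟩, fun h => he (by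
    have := h (0, i) (Or.inl rfl)
    simpa using this)⟩
  have comm : ∀ a ∈ S, ∀ x k, k = i ∨ k = j → z.1 (a (x, k)) = a (z.1 (x, k)) := by
    intro a ha x k hk
    have := hz ⟨a, ha⟩ (x, k) hk
    change (a * z.1)⁻¹ (z.1 (a (x, k))) = (x, k) at this
    rw [Equiv.Perm.inv_eq_iff_eq] at this
    exact this
  have form : ∀ k, k = i ∨ k = j → ∀ x, z.1 (x, k) = (x + disp z.1 k 0, k) := by
    intro k hk x
    have := comm _ (hS.addRight_mem x) 0 k hk
    rw [Equiv.coe_addRight, hS.apply_eq z.2 0 k] at this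
    simp only [Prod.mk_add_mk, zero_add, add_zero] at this
    rw [this, add_comm]
  have per : ∀ k, k = i ∨ k = j → disp z.1 k 0 ∈ dispPeriods S k := by
    intro k hk
    rw [mem_dispPeriods]
    intro a ha x
    have := comm a ha x k hk
    rw [form k hk, hS.apply_eq ha, form k hk, hS.apply_eq ha] at this
    have := congrArg Prod.fst this
    simp only at this
    rw [add_right_comm] at this
    rw [add_right_inj] at this
    exact this.symm
  refine ⟨z, z.2, disp z.1 i 0, disp z.1 j 0, ?_, form i (Or.inl rfl), form j (Or.inr rfl),
    per i (Or.inl rfl), per j (Or.inr rfl)⟩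
  by_contra! h
  apply hzN
  rintro ⟨x, k⟩ (hk | hk) <;> simp only at hk <;> subst hk
  · rw [form _ (Or.inl rfl), h.1, add_zero]
  · rw [form _ (Or.inr rfl), h.2, add_zero]

theorem exists_mem_dispPeriods {p : ℕ} [hp : Fact p.Prime]
    {S : Subgroup (Equiv.Perm ((ZMod p × ZMod p) × ZMod 4))}
    (hS : IsBlockGroup S) (i : ZMod 4) : ∃ v ∈ dispPeriods S i, v ≠ 0 := by
  obtain ⟨z, _, v, w, hvw, _, _, hv, hw⟩ := hS.exists_central i i
  rcases hvw with h | h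
  exacts [⟨v, hv, h⟩, ⟨w, hw, h⟩]

end IsBlockGroup

theorem fixed_of_iterate_prime_pow {p : ℕ} [hp : Fact p.Prime] {φ : ZMod p → ZMod p} {n : ℕ}
    (h : φ^[p ^ n] = id) (h0 : φ 0 = 0) (m : ZMod p) : φ m = m := by
  classical
  let ψ : Function.End (ZMod p) := φ
  have h1 : ψ ^ p ^ n = 1 :=
    (hom_coe_pow (fun g : Function.End (ZMod p) => g) rfl (fun g h => rfl) ψ (p ^ n)).trans h
  have h2 := Equiv.Perm.card_fixedPoints_modEq h1
  rw [ZMod.card] at h2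
  have h3 : p ∣ Fintype.card (Function.fixedPoints φ) :=
    (Nat.modEq_zero_iff_dvd.1 (h2.symm.trans (Nat.modEq_zero_iff_dvd.2 dvd_rfl)))
  have h4 : 0 < Fintype.card (Function.fixedPoints φ) := Fintype.card_pos_iff.2 ⟨⟨0, h0⟩⟩
  have h5 := Nat.le_of_dvd h4 h3
  by_contra h6
  have h7 : Fintype.card (Function.fixedPoints φ) < Fintype.card (ZMod p) :=
    Fintype.card_subtype_lt (x := m) h6
  rw [ZMod.card] at h7
  exact absurd h7 (not_lt.2 h5)

namespace IsBlockGroup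

theorem disp_addRight_mul {p : ℕ} (a : Equiv.Perm ((ZMod p × ZMod p) × ZMod 4))
    (v : ZMod p × ZMod p) (i : ZMod 4) (x : ZMod p × ZMod p) :
    disp (Equiv.addRight (v, (0 : ZMod 4)) * a) i x = disp a i x + v := by
  simp [disp, Equiv.Perm.mul_apply]
  abel

theorem det2_disp_eq {p : ℕ} [hp : Fact p.Prime]
    {S : Subgroup (Equiv.Perm ((ZMod p × ZMod p) × ZMod 4))}
    (hS : IsBlockGroup S) {i : ZMod 4} {v : ZMod p × ZMod p} (hv : v ∈ dispPeriods S i)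
    {a : Equiv.Perm ((ZMod p × ZMod p) × ZMod 4)} (ha : a ∈ S) (x y : ZMod p × ZMod p) :
    det2 v (disp a i x) = det2 v (disp a i y) := by
  by_cases hv0 : v = 0
  · simp [hv0, det2]
  suffices key : ∀ a ∈ S, disp a i 0 = 0 → ∀ x, det2 v (disp a i x) = 0 by
    have h := key _ (S.mul_mem (hS.addRight_mem (-disp a i 0)) ha)
      (by rw [disp_addRight_mul, add_neg_cancel])
    simp only [disp_addRight_mul, det2_add] at h
    exact add_right_cancel ((h x).trans (h y).symm)
  clear ha x y a
  intro a ha h0 x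
  obtain ⟨e, he⟩ := exists_det2_eq_one hv0
  rw [mem_dispPeriods] at hv
  have red : ∀ x, disp a i x = disp a i (det2 v x • e) := by
    intro x
    conv_lhs => rw [det2_coords he x, add_comm]
    exact eq_smul_period (hv a ha) _ _
  let φ : ZMod p → ZMod p := fun m => m + det2 v (disp a i (m • e))
  have semi : ∀ n : ℕ, ∀ x, φ^[n] (det2 v x) = det2 v ((a ^ n) (x, i)).1 := by
    intro n
    induction n with
    | zero => simp
    | succ n ih =>
      intro x
      rw [Function.iterate_succ_apply, pow_succ, Equiv.Perm.mul_apply, hS.apply_eq ha, ← ih]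
      congr 1
      rw [det2_add, red x]
  obtain ⟨n, hn⟩ := hS.isPGroup ⟨a, ha⟩
  have hn' : a ^ p ^ n = 1 := congrArg Subtype.val hn
  have := fixed_of_iterate_prime_pow (φ := φ) (n := n) (by
    funext m
    have := semi (p ^ n) (m • e)
    rw [hn', det2_smul, he, mul_one] at this
    simpa [det2_smul, he] using this) (by simp [φ, h0]) (det2 v x)
  rw [red x]
  simpa [φ] using this

theorem dispPeriods_eq_top_iff {p : ℕ}
    {S : Subgroup (Equiv.Perm ((ZMod p × ZMod p) × ZMod 4))}
    (hS : IsBlockGroup S) {i : ZMod 4} :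
    dispPeriods S i = ⊤ ↔ ∀ a ∈ S, ∀ b ∈ S, ∀ x, a (b (x, i)) = b (a (x, i)) := by
  constructor
  · intro h a ha b hb x
    have key : ∀ a ∈ S, ∀ x y, disp a i x = disp a i y := by
      intro a ha x y
      have hm : x - y ∈ dispPeriods S i := by rw [h]; trivial
      have := mem_dispPeriods.1 hm a ha y
      rwa [add_sub_cancel] at this
    rw [hS.apply_eq hb, hS.apply_eq ha, hS.apply_eq ha, hS.apply_eq hb, key a ha (x + disp b i x) x,
      key b hb (x + disp a i x) x, add_right_comm]
  · intro h
    rw [eq_top_iff]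
    intro v _
    rw [mem_dispPeriods]
    intro a ha x
    have := h a ha _ (hS.addRight_mem v) x
    have e : (x, i) + (v, 0) = (x + v, i) := Prod.ext rfl (add_zero i)
    change a ((x, i) + (v, 0)) = a (x, i) + (v, 0) at this
    rw [e, hS.apply_eq ha (x + v), hS.apply_eq ha x] at this
    have := congrArg Prod.fst this
    change x + v + disp a i (x + v) = x + disp a i x + v at this
    rw [add_right_comm] at this
    exact add_left_cancel (add_right_cancel this)

theorem dispPeriods_eq_top_of_normalize {p : ℕ}
    {S : Subgroup (Equiv.Perm ((ZMod p × ZMod p) × ZMod 4))} (hS : IsBlockGroup S)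
    {n : Equiv.Perm ((ZMod p × ZMod p) × ZMod 4)} (hn : ∀ a ∈ S, n * a * n⁻¹ ∈ S)
    (hshift : ∀ x, (n x).2 = x.2 + 1) {i : ZMod 4} (h : dispPeriods S i = ⊤) (j : ZMod 4) :
    dispPeriods S j = ⊤ := by
  have step : ∀ j, dispPeriods S (j + 1) = ⊤ → dispPeriods S j = ⊤ := by
    intro j hj
    rw [hS.dispPeriods_eq_top_iff] at hj ⊢
    intro a ha b hb x
    have := hj _ (hn a ha) _ (hn b hb) (n (x, j)).1
    have e : ((n (x, j)).1, j + 1) = n (x, j) := Prod.ext rfl (hshift (x, j)).symm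
    rw [e] at this
    simpa [Equiv.Perm.mul_apply] using this
  have all : ∀ k : ℕ, dispPeriods S (i - k) = ⊤ := by
    intro k
    induction k with
    | zero => simpa using h
    | succ k ih =>
      apply step
      push_cast
      rwa [← sub_sub, sub_add_cancel]
  have := all (i - j).val
  rwa [ZMod.natCast_zmod_val, sub_sub_cancel] at this

theorem mem_dispPeriods_iff_det2 {p : ℕ} [hp : Fact p.Prime]
    {S : Subgroup (Equiv.Perm ((ZMod p × ZMod p) × ZMod 4))} {i : ZMod 4}
    (htop : dispPeriods S i ≠ ⊤) {v : ZMod p × ZMod p} (hv : v ∈ dispPeriods S i) (hv0 : v ≠ 0)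
    {w : ZMod p × ZMod p} : w ∈ dispPeriods S i ↔ det2 v w = 0 := by
  constructor
  · intro hw
    by_contra h
    apply htop
    rw [eq_top_iff]
    intro x _
    have e : x = (-(det2 v w)⁻¹ * det2 w x) • v + ((det2 v w)⁻¹ * det2 v x) • w := by
      have : det2 v ((det2 v w)⁻¹ • w) = 1 := by rw [det2_smul, inv_mul_cancel₀ h]
      conv_lhs => rw [det2_coords this x, smul_det2]
      module
    rw [e]
    exact add_mem (zmod_smul_mem _ _ hv) (zmod_smul_mem _ _ hw)
  · intro hw
    obtain ⟨t, rfl⟩ := eq_smul_of_det2_eq_zero hv0 hw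
    exact zmod_smul_mem _ _ hv

theorem color_disp {p : ℕ} {C : Type*} {χ : (ZMod p × ZMod p) × ZMod 4 → C}
    {S : Subgroup (Equiv.Perm ((ZMod p × ZMod p) × ZMod 4))} (hS : IsBlockGroup S)
    (hc : S ≤ colorAut χ) {a : Equiv.Perm ((ZMod p × ZMod p) × ZMod 4)} (ha : a ∈ S)
    (i s : ZMod 4) (x y : ZMod p × ZMod p) :
    χ (y - x + disp a (i + s) y - disp a i x, s) = χ (y - x, s) := by
  have := hc ha (x, i) (y, i + s)
  rw [hS.apply_eq ha, hS.apply_eq ha] at this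
  change χ (y + disp a (i + s) y - (x + disp a i x), i + s - i) = χ (y - x, i + s - i) at this
  rw [add_sub_cancel_left i s] at this
  rw [← this]
  congr 2
  abel

theorem periods_disp {p : ℕ} {C : Type*} {χ : (ZMod p × ZMod p) × ZMod 4 → C}
    {S : Subgroup (Equiv.Perm ((ZMod p × ZMod p) × ZMod 4))} (hS : IsBlockGroup S)
    (hc : S ≤ colorAut χ) {a : Equiv.Perm ((ZMod p × ZMod p) × ZMod 4)} (ha : a ∈ S)
    (i s : ZMod 4) (x y : ZMod p × ZMod p) :
    y - x + disp a i y - disp a i x ∈ periods (fun u => χ (u, s)) ↔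
      y - x ∈ periods (fun u => χ (u, s)) := by
  have key : ∀ x y, y - x ∈ periods (fun u => χ (u, s)) ↔ ∀ z, χ (z - x, s) = χ (z - y, s) := by
    intro x y
    rw [mem_periods]
    constructor
    · intro h z
      have := h (z - y)
      simpa using this
    · intro h z
      have := h (z + y)
      simpa [add_sub_assoc] using this
  have e : y - x + disp a i y - disp a i x = (y + disp a i y) - (x + disp a i x) := by abel
  rw [e, key, key]
  constructor
  · intro h z
    have := h (z + disp a (i + s) z)
    rw [← hS.color_disp hc ha i s x z, ← hS.color_disp hc ha i s y z]
    convert this using 3 <;> abel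
  · intro h z
    obtain ⟨w, rfl⟩ : ∃ w, w + disp a (i + s) w = z := by
      refine ⟨(a⁻¹ (z, i + s)).1, ?_⟩
      have e1 : ((a⁻¹ (z, i + s)).1, i + s) = a⁻¹ (z, i + s) :=
        Prod.ext rfl (hS.le_fiberPerm (S.inv_mem ha) (z, i + s)).symm
      have e2 := hS.apply_eq ha (a⁻¹ (z, i + s)).1 (i + s)
      rw [e1, Equiv.Perm.inv_def, Equiv.apply_symm_apply] at e2
      exact (congrArg Prod.fst e2).symm
    have := h w
    rw [← hS.color_disp hc ha i s x w, ← hS.color_disp hc ha i s y w] at this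
    convert this using 3 <;> abel

theorem exists_disp_ne {p : ℕ} {S : Subgroup (Equiv.Perm ((ZMod p × ZMod p) × ZMod 4))}
    {i : ZMod 4} (h : dispPeriods S i ≠ ⊤) : ∃ a ∈ S, ∃ x y, disp a i x ≠ disp a i y := by
  by_contra! hcon
  apply h
  rw [eq_top_iff]
  intro v _
  rw [mem_dispPeriods]
  exact fun a ha x => hcon a ha _ _

theorem periods_eq_top {p : ℕ} [hp : Fact p.Prime] (hp2 : p ≠ 2) {C : Type*}
    {χ : (ZMod p × ZMod p) × ZMod 4 → C}
    {S : Subgroup (Equiv.Perm ((ZMod p × ZMod p) × ZMod 4))} (hS : IsBlockGroup S)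
    (hc : S ≤ colorAut χ) {i : ZMod 4} (s : ZMod 4) (htop : dispPeriods S i ≠ ⊤)
    {w : ZMod p × ZMod p} (hw : w ∈ periods (fun u => χ (u, s))) (hwi : w ∉ dispPeriods S i) :
    periods (fun u => χ (u, s)) = ⊤ := by
  obtain ⟨v, hv, hv0⟩ := hS.exists_mem_dispPeriods i
  obtain ⟨a, ha, hne⟩ := exists_disp_ne htop
  rw [mem_dispPeriods_iff_det2 htop hv hv0] at hwi
  have := line_const_of_invariant hp2 (F := fun u => u ∈ periods (fun u => χ (u, s)))
    (d := fun _ => disp a i) hv0 (fun _ => mem_dispPeriods.1 hv a ha)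
    (fun _ => hS.det2_disp_eq hv ha)
    (fun _ x y => propext (hS.periods_disp hc ha i s x y)) hne hwi 1
  rw [one_smul] at this
  have hvT : v ∈ periods (fun u => χ (u, s)) := by
    have h1 : w + v ∈ periods (fun u => χ (u, s)) := this.symm ▸ hw
    simpa using sub_mem h1 hw
  rw [eq_top_iff]
  intro x _
  have h1 : det2 v ((det2 v w)⁻¹ • w) = 1 := by rw [det2_smul, inv_mul_cancel₀ hwi]
  rw [det2_coords h1 x, smul_smul]
  exact add_mem (zmod_smul_mem _ _ hvT) (zmod_smul_mem _ _ hw)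

theorem dispPeriods_eq_of_ne {p : ℕ} [hp : Fact p.Prime] (hp2 : p ≠ 2) {C : Type*}
    {χ : (ZMod p × ZMod p) × ZMod 4 → C}
    {S : Subgroup (Equiv.Perm ((ZMod p × ZMod p) × ZMod 4))} (hS : IsBlockGroup S)
    (hc : S ≤ colorAut χ) (htop : ∀ i, dispPeriods S i ≠ ⊤) {s : ZMod 4}
    (hs : ∃ u u', χ (u, s) ≠ χ (u', s)) (i : ZMod 4) :
    dispPeriods S (i + s) = dispPeriods S i := by
  obtain ⟨z, hz, v, w, hvw, hzv, hzw, hv, hw⟩ := hS.exists_central i (i + s)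
  have hT : w - v ∈ periods (fun u => χ (u, s)) := by
    intro u
    have := hc hz (0, i) (u, i + s)
    rw [hzv, hzw] at this
    simp only [Prod.mk_sub_mk, add_sub_cancel_left, zero_add, sub_zero] at this
    simpa [add_sub_assoc] using this
  have hnt : periods (fun u => χ (u, s)) ≠ ⊤ := by
    intro h
    obtain ⟨u, u', hu⟩ := hs
    have hm : u - u' ∈ periods (fun u => χ (u, s)) := by rw [h]; trivial
    have := hm u'
    rw [add_sub_cancel] at this
    exact hu this
  have h1 : w - v ∈ dispPeriods S i := by
    by_contra h
    exact hnt (hS.periods_eq_top hp2 hc s (htop _) hT h)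
  have h2 : w - v ∈ dispPeriods S (i + s) := by
    by_contra h
    exact hnt (hS.periods_eq_top hp2 hc s (htop _) hT h)
  have hw' : w ∈ dispPeriods S i := by simpa using add_mem h1 hv
  have hv' : v ∈ dispPeriods S (i + s) := by simpa using sub_mem hw h2
  ext x
  rcases hvw with h | h
  · rw [mem_dispPeriods_iff_det2 (htop _) hv h, mem_dispPeriods_iff_det2 (htop _) hv' h]
  · rw [mem_dispPeriods_iff_det2 (htop _) hw' h, mem_dispPeriods_iff_det2 (htop _) hw h]

theorem color_add_eq {p : ℕ} [hp : Fact p.Prime] (hp2 : p ≠ 2) {C : Type*}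
    {χ : (ZMod p × ZMod p) × ZMod 4 → C}
    {S : Subgroup (Equiv.Perm ((ZMod p × ZMod p) × ZMod 4))} (hS : IsBlockGroup S)
    (hc : S ≤ colorAut χ) (htop : ∀ i, dispPeriods S i ≠ ⊤) (i s : ZMod 4)
    {u l : ZMod p × ZMod p} (hu : u ∉ dispPeriods S i) (hl : l ∈ dispPeriods S i) :
    χ (u + l, s) = χ (u, s) := by
  by_cases hs : ∃ u u', χ (u, s) ≠ χ (u', s)
  swap
  · push Not at hs
    exact hs _ _
  have hper : ∀ k : ZMod 4, dispPeriods S (i + k * s) = dispPeriods S i := by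
    have : ∀ k : ℕ, dispPeriods S (i + k * s) = dispPeriods S i := by
      intro k
      induction k with
      | zero => simp
      | succ k ih =>
        have := hS.dispPeriods_eq_of_ne hp2 hc htop hs (i + k * s)
        rw [add_assoc, ← add_one_mul, ih] at this
        exact_mod_cast this
    intro k
    have := this k.val
    rwa [ZMod.natCast_zmod_val] at this
  obtain ⟨v, hv, hv0⟩ := hS.exists_mem_dispPeriods i
  rw [mem_dispPeriods_iff_det2 (htop i) hv hv0] at hu hl
  obtain ⟨t, rfl⟩ := eq_smul_of_det2_eq_zero hv0 hl
  obtain ⟨a, ha, hne⟩ := exists_disp_ne (htop i)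
  have hv' : ∀ k : ZMod 4, v ∈ dispPeriods S (i + k * s) := fun k => by rw [hper]; exact hv
  refine line_const_of_invariant hp2 (F := fun u => χ (u, s))
    (d := fun k => disp a (i + k * s)) hv0 (fun k => mem_dispPeriods.1 (hv' k) a ha)
    (fun k => hS.det2_disp_eq (hv' k) ha) ?_ (by simpa using hne) hu t
  intro k x y
  have := hS.color_disp hc ha (i + k * s) s x y
  rwa [add_assoc, ← add_one_mul] at this

theorem disp_eq_of_linked {p : ℕ} [hp : Fact p.Prime] (hp2 : p ≠ 2) {C : Type*}
    {χ : (ZMod p × ZMod p) × ZMod 4 → C}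
    {S : Subgroup (Equiv.Perm ((ZMod p × ZMod p) × ZMod 4))} (hS : IsBlockGroup S)
    (hc : S ≤ colorAut χ) (htop : ∀ i, dispPeriods S i ≠ ⊤) {i s : ZMod 4}
    {l : ZMod p × ZMod p} (hl : l ∈ dispPeriods S i) (hne : χ (l, s) ≠ χ (0, s))
    {a : Equiv.Perm ((ZMod p × ZMod p) × ZMod 4)} (ha : a ∈ S) :
    disp a (i + s) = disp a i := by
  have hper := hS.dispPeriods_eq_of_ne hp2 hc htop ⟨_, _, hne⟩ i
  obtain ⟨v, hv, hv0⟩ := hS.exists_mem_dispPeriods i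
  have hv' : v ∈ dispPeriods S (i + s) := by rw [hper]; exact hv
  have hdet : ∀ x, det2 v (disp a (i + s) x - disp a i x) = 0 := by
    intro x
    have e : det2 v (disp a (i + s) x - disp a i x) = det2 v (disp a (i + s) 0 - disp a i 0) := by
      rw [det2_sub, det2_sub, hS.det2_disp_eq hv ha x 0, hS.det2_disp_eq hv' ha x 0]
    rw [e]
    by_contra h
    rw [← mem_dispPeriods_iff_det2 (htop i) hv hv0] at h
    have main : ∀ l ∈ dispPeriods S i, χ (l, s) = χ (disp a (i + s) 0 - disp a i 0, s) := by
      intro l hl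
      have h1 := hS.color_disp hc ha i s 0 l
      have h2 := mem_dispPeriods.1 (hper ▸ hl : l ∈ dispPeriods S (i + s)) a ha 0
      rw [zero_add] at h2
      rw [sub_zero, h2] at h1
      rw [← h1, ← hS.color_add_eq hp2 hc htop i s h hl]
      congr 2
      abel
    exact hne ((main l hl).trans (main 0 (zero_mem _)).symm)
  funext x
  obtain ⟨t, ht⟩ := eq_smul_of_det2_eq_zero hv0 (hdet x)
  by_contra hx
  have ht0 : t ≠ 0 := by
    rintro rfl
    rw [zero_smul] at ht
    exact hx (sub_eq_zero.1 ht)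
  obtain ⟨r, rfl⟩ := eq_smul_of_det2_eq_zero hv0 ((mem_dispPeriods_iff_det2 (htop i) hv hv0).1 hl)
  have := eq_of_add_period (F := fun r : ZMod p => χ (r • v, s)) ht0 (fun r => by
    have h1 := hS.color_disp hc ha i s x (r • v + x)
    have h2 := mem_dispPeriods.1 hv' a ha x
    rw [add_comm (r • v) x, eq_smul_period (mem_dispPeriods.1 hv' a ha) x r, add_sub_cancel_left,
      add_sub_assoc, ht, ← add_smul] at h1
    exact h1) r 0
  simp only [zero_smul] at this
  exact hne this

end IsBlockGroup

theorem exists_straightening {p : ℕ} [hp : Fact p.Prime]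
    {act : ZMod p × ZMod p → ZMod p × ZMod p → ZMod p × ZMod p}
    (hadd : ∀ w w' x, act (w + w') x = act w (act w' x)) (htr : ∀ x y, ∃ w, act w x = y)
    {l : ZMod p × ZMod p} (hl : l ≠ 0) (hper : ∀ w x, act w (x + l) = act w x + l)
    (hdet : ∀ w x y, det2 l (act w x - x) = det2 l (act w y - y)) :
    ∃ v : ZMod p × ZMod p → ZMod p × ZMod p, (∀ x, det2 l (v x) = 0) ∧ (∀ x, v (x + l) = v x) ∧
      ∀ w x y, act w x + v (act w x) - (x + v x) = act w y + v (act w y) - (y + v y) := by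
  have hper' : ∀ w x (t : ZMod p), act w (x + t • l) = act w x + t • l := by
    intro w x t
    have := eq_smul_period (F := fun x => act w x - x) (a := l)
      (fun x => by simp only [hper]; abel) x t
    rw [sub_eq_iff_eq_add] at this
    rw [this]
    abel
  have hdet0 : ∀ w x, det2 l (act w x) = det2 l x + det2 l (act w 0) := by
    intro w x
    have := hdet w x 0
    rw [sub_zero, det2_sub] at this
    rw [← this]
    ring
  let δ : ZMod p × ZMod p →+ ZMod p := AddMonoidHom.mk' (fun w => det2 l (act w 0)) (fun w w' => by
    rw [hadd, hdet0, add_comm])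
  have hδ : ∀ w, det2 l (act w 0) = δ w := fun _ => rfl
  obtain ⟨e, he⟩ := exists_det2_eq_one hl
  obtain ⟨w₀, hw₀⟩ := htr 0 e
  have hδ0 : ∀ k : ZMod p, δ (k • w₀) = k := by
    intro k
    rw [ZMod.map_smul, ← hδ, hw₀, he, smul_eq_mul, mul_one]
  let y : ZMod p → ZMod p × ZMod p := fun k => act (k • w₀) 0
  have hy : ∀ k, det2 l (y k) = k := fun k => (hδ _).trans (hδ0 k)
  have hyadd : ∀ k j, act (k • w₀) (y j) = y (k + j) := by
    intro k j
    simp only [y]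
    rw [← hadd, ← add_smul]
  have hx : ∀ x, ∃ t : ZMod p, x = y (det2 l x) + t • l := by
    intro x
    obtain ⟨t, ht⟩ := eq_smul_of_det2_eq_zero (x := x - y (det2 l x)) hl
      (by rw [det2_sub, hy, sub_self])
    exact ⟨t, by rw [← ht]; abel⟩
  refine ⟨fun x => det2 l x • y 1 - y (det2 l x), fun x => ?_, fun x => ?_, ?_⟩
  · rw [det2_sub, det2_smul, hy, hy, mul_one, sub_self]
  · simp only [det2_add, det2_self, add_zero]
  · intro w
    obtain ⟨r, hr⟩ := hx (act w 0)
    rw [hδ] at hr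
    have key : ∀ x, act w x + (det2 l (act w x) • y 1 - y (det2 l (act w x))) -
        (x + (det2 l x • y 1 - y (det2 l x))) = r • l + δ w • y 1 := by
      intro x
      obtain ⟨t, ht⟩ := hx x
      have e1 : act w x = y (det2 l x + δ w) + (r + t) • l := by
        conv_lhs => rw [ht, hper']
        have : act w (y (det2 l x)) = y (det2 l x + δ w) + r • l := by
          calc act w (y (det2 l x)) = act (w + det2 l x • w₀) 0 := (hadd _ _ _).symm
            _ = act (det2 l x • w₀) (act w 0) := by rw [add_comm, hadd]
            _ = _ := by rw [hr, hper', hyadd]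
        rw [this]
        module
      have e2 : det2 l (act w x) = det2 l x + δ w := by rw [hdet0, hδ]
      have e3 : x - y (det2 l x) = t • l := sub_eq_iff_eq_add'.2 ht
      have e4 : x + (det2 l x • y 1 - y (det2 l x)) = t • l + det2 l x • y 1 := by
        rw [← e3]
        abel
      rw [e4, e2, e1]
      module
    intro x z
    rw [key, key]

theorem color_mul {A C : Type*} [AddCommGroup A] {χ χ' : A → C} {f k : Equiv.Perm A}
    (hf : ∀ x y, χ' (f y - f x) = χ (y - x)) (hk : k ∈ colorAut χ) (x y : A) :
    χ' ((f * k) y - (f * k) x) = χ (y - x) := by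
  rw [Equiv.Perm.mul_apply, Equiv.Perm.mul_apply, hf, hk]

theorem affine_of_disp_const {p : ℕ} {f : Equiv.Perm ((ZMod p × ZMod p) × ZMod 4)}
    (hb : ∀ x, (f x).2 = x.2)
    (h : ∀ i w x y, disp (f⁻¹ * Equiv.addRight (w, 0) * f) i x =
      disp (f⁻¹ * Equiv.addRight (w, 0) * f) i y) (i : ZMod 4) (x b : ZMod p × ZMod p) :
    (f (x + b, i)).1 - (f (b, i)).1 = (f (x, i)).1 - (f (0, i)).1 := by
  set w := (f (x, i)).1 - (f (0, i)).1 with hw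
  have e0 : (f⁻¹ * Equiv.addRight (w, 0) * f : Equiv.Perm _) (0, i) = (x, i) := by
    change f⁻¹ (f (0, i) + (w, 0)) = (x, i)
    rw [Equiv.Perm.inv_eq_iff_eq]
    refine Prod.ext ?_ ?_
    · simp [hw]
    · simp [hb]
  have e1 : disp (f⁻¹ * Equiv.addRight (w, 0) * f) i 0 = x := by
    rw [disp, e0, sub_zero]
  have e2 := h i w b 0
  rw [e1, disp, sub_eq_iff_eq_add] at e2
  have e3 : f⁻¹ (f (b, i) + (w, 0)) = (x + b, i) := by
    refine Prod.ext e2 ?_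
    have := hb (f⁻¹ (f (b, i) + (w, 0)))
    simpa [hb] using this.symm
  rw [Equiv.Perm.inv_eq_iff_eq] at e3
  rw [← e3]
  simp

theorem exists_addEquiv_of_blockGroup {p : ℕ} [hp : Fact p.Prime] (hp2 : p ≠ 2) {C : Type*}
    {χ χ' : (ZMod p × ZMod p) × ZMod 4 → C}
    {S : Subgroup (Equiv.Perm ((ZMod p × ZMod p) × ZMod 4))} (hS : IsBlockGroup S)
    (hc : S ≤ colorAut χ) {n : Equiv.Perm ((ZMod p × ZMod p) × ZMod 4)}
    (hn : ∀ a ∈ S, n * a * n⁻¹ ∈ S) (hshift : ∀ x, (n x).2 = x.2 + 1)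
    {f : Equiv.Perm ((ZMod p × ZMod p) × ZMod 4)} (hf : ∀ x y, χ' (f y - f x) = χ (y - x))
    (hb : ∀ x, (f x).2 = x.2) (hq : ∀ w, f⁻¹ * Equiv.addRight (w, 0) * f ∈ S) :
    ∃ φ : ((ZMod p × ZMod p) × ZMod 4) ≃+ ((ZMod p × ZMod p) × ZMod 4), ∀ x, χ' (φ x) = χ x := by
  by_cases htop : ∃ i, dispPeriods S i = ⊤
  · obtain ⟨i, hi⟩ := htop
    have hall := fun j => hS.dispPeriods_eq_top_of_normalize hn hshift hi j
    refine exists_addEquiv_of_affine hp2 f hf hb (affine_of_disp_const hb ?_)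
    intro i w x y
    have hm : x - y ∈ dispPeriods S i := by rw [hall]; trivial
    have := mem_dispPeriods.1 hm _ (hq w) y
    rwa [add_sub_cancel] at this
  push Not at htop
  let q : ZMod p × ZMod p → Equiv.Perm ((ZMod p × ZMod p) × ZMod 4) := fun w =>
    f⁻¹ * Equiv.addRight (w, 0) * f
  let act : ZMod 4 → ZMod p × ZMod p → ZMod p × ZMod p → ZMod p × ZMod p := fun i w x =>
    x + disp (q w) i x
  have hqact : ∀ i w x, q w (x, i) = (act i w x, i) := fun i w x => hS.apply_eq (hq w) x i
  let Good : (ZMod p × ZMod p → ZMod p × ZMod p → ZMod p × ZMod p) → AddSubgroup (ZMod p × ZMod p) →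
      (ZMod p × ZMod p → ZMod p × ZMod p) → Prop := fun act L v =>
    (∀ x, v x ∈ L) ∧ (∀ x, ∀ l ∈ L, v (x + l) = v x) ∧
      ∀ w x y, act w x + v (act w x) - (x + v x) = act w y + v (act w y) - (y + v y)
  have hgood : ∀ i, ∃ v, Good (act i) (dispPeriods S i) v := by
    intro i
    obtain ⟨l, hl, hl0⟩ := hS.exists_mem_dispPeriods i
    obtain ⟨v, h1, h2, h3⟩ := exists_straightening (act := act i) (l := l) (by
        intro w w' x
        have : q (w + w') = q w * q w' := by
          ext1 z
          simp only [q, Equiv.Perm.mul_apply, Equiv.coe_addRight]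
          congr 1
          rw [Equiv.Perm.inv_def, Equiv.apply_symm_apply, add_assoc]
          congr 1
          exact Prod.ext (add_comm w w') (add_zero 0).symm
        have e := hqact i (w + w') x
        rw [this, Equiv.Perm.mul_apply, hqact, hqact] at e
        exact (congrArg Prod.fst e).symm) (by
        intro x y
        refine ⟨(f (y, i)).1 - (f (x, i)).1, ?_⟩
        have e := hqact i ((f (y, i)).1 - (f (x, i)).1) x
        have : q ((f (y, i)).1 - (f (x, i)).1) (x, i) = (y, i) := by
          change f⁻¹ (f (x, i) + _) = (y, i)
          rw [Equiv.Perm.inv_eq_iff_eq]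
          refine Prod.ext ?_ ?_
          · simp
          · simp [hb]
        rw [this] at e
        exact (congrArg Prod.fst e).symm) hl0 (by
        intro w x
        simp only [act]
        rw [mem_dispPeriods.1 hl _ (hq w)]
        abel) (by
        intro w x y
        simp only [act, add_sub_cancel_left]
        exact hS.det2_disp_eq hl (hq w) x y)
    refine ⟨v, fun x => (IsBlockGroup.mem_dispPeriods_iff_det2 (htop i) hl hl0).2 (h1 x), ?_, h3⟩
    intro x m hm
    obtain ⟨t, rfl⟩ := eq_smul_of_det2_eq_zero hl0
      ((IsBlockGroup.mem_dispPeriods_iff_det2 (htop i) hl hl0).1 hm)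
    exact eq_smul_period h2 x t
  let v : ZMod 4 → ZMod p × ZMod p → ZMod p × ZMod p := fun i =>
    Classical.epsilon (Good (act i) (dispPeriods S i))
  have hv : ∀ i, Good (act i) (dispPeriods S i) (v i) := fun i => Classical.epsilon_spec (hgood i)
  let B : Equiv.Perm ((ZMod p × ZMod p) × ZMod 4) :=
    { toFun := fun x => (x.1 + v x.2 x.1, x.2)
      invFun := fun x => (x.1 - v x.2 x.1, x.2)
      left_inv := fun x => by
        simp only
        rw [(hv x.2).2.1 _ _ ((hv x.2).1 _), add_sub_cancel_right]
      right_inv := fun x => by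
        simp only
        rw [sub_eq_add_neg, (hv x.2).2.1 _ _ (neg_mem ((hv x.2).1 _)), neg_add_cancel_right] }
  have hBcolor : B ∈ colorAut χ := by
    rintro ⟨x, i⟩ ⟨y, j⟩
    obtain ⟨s, rfl⟩ : ∃ s, j = i + s := ⟨j - i, by abel⟩
    change χ (y + v (i + s) y - (x + v i x), i + s - i) = χ (y - x, i + s - i)
    rw [add_sub_cancel_left]
    by_cases hs : ∃ u u', χ (u, s) ≠ χ (u', s)
    swap
    · push Not at hs
      exact hs _ _
    have hL := hS.dispPeriods_eq_of_ne hp2 hc htop hs i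
    have e : y + v (i + s) y - (x + v i x) = y - x + (v (i + s) y - v i x) := by abel
    rw [e]
    have hm : v (i + s) y - v i x ∈ dispPeriods S i :=
      sub_mem (hL ▸ (hv (i + s)).1 y) ((hv i).1 x)
    by_cases hxy : y - x ∈ dispPeriods S i
    · by_cases hlink : ∃ l ∈ dispPeriods S i, χ (l, s) ≠ χ (0, s)
      · obtain ⟨l, hl, hne⟩ := hlink
        have hact : act (i + s) = act i := by
          funext w z
          simp only [act]
          rw [hS.disp_eq_of_linked hp2 hc htop hl hne (hq w)]
        have hvv : v (i + s) = v i := by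
          simp only [v]
          rw [hact, hL]
        have := (hv i).2.1 x _ hxy
        rw [add_sub_cancel] at this
        rw [hvv, this, sub_self, add_zero]
      · push Not at hlink
        rw [hlink _ hxy, hlink _ (add_mem hxy hm)]
    · exact hS.color_add_eq hp2 hc htop i s hxy hm
  have hBb : ∀ x, (B x).2 = x.2 := fun _ => rfl
  have hBb' : ∀ x, (B⁻¹ x).2 = x.2 := fun _ => rfl
  refine exists_addEquiv_of_affine hp2 (f * B⁻¹) (color_mul hf (inv_mem hBcolor))
    (fun x => by rw [Equiv.Perm.mul_apply, hb, hBb']) (affine_of_disp_const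
    (fun x => by rw [Equiv.Perm.mul_apply, hb, hBb']) ?_)
  intro i w
  have key : ∀ x, disp ((f * B⁻¹)⁻¹ * Equiv.addRight (w, 0) * (f * B⁻¹)) i (x + v i x) =
      act i w x + v i (act i w x) - (x + v i x) := by
    intro x
    have e1 : (f * B⁻¹)⁻¹ * Equiv.addRight (w, 0) * (f * B⁻¹) = B * q w * B⁻¹ := by
      simp only [q]
      group
    have e2 : B⁻¹ (x + v i x, i) = (x, i) := by
      rw [Equiv.Perm.inv_eq_iff_eq]
      rfl
    rw [disp, e1, Equiv.Perm.mul_apply, Equiv.Perm.mul_apply, e2, hqact]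
    rfl
  have hsurj : ∀ z, ∃ x, x + v i x = z := fun z =>
    ⟨z - v i z, by rw [sub_eq_add_neg, (hv i).2.1 _ _ (neg_mem ((hv i).1 _)), neg_add_cancel_right]⟩
  intro x y
  obtain ⟨x, rfl⟩ := hsurj x
  obtain ⟨y, rfl⟩ := hsurj y
  rw [key, key]
  exact (hv i).2.2 w x y

/-- The translations of the plane, acting on each block. -/
def blockTranslations (p : ℕ) : Subgroup (Equiv.Perm ((ZMod p × ZMod p) × ZMod 4)) :=
  MonoidHom.range
    { toFun := fun v : Multiplicative (ZMod p × ZMod p) =>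
        Equiv.addRight ((v.toAdd, 0) : (ZMod p × ZMod p) × ZMod 4)
      map_one' := by
        ext1 x
        exact Prod.ext (add_zero _) (add_zero _)
      map_mul' := fun v w => by
        ext1 x
        refine Prod.ext ?_ ?_
        · change x.1 + (v.toAdd + w.toAdd) = x.1 + w.toAdd + v.toAdd
          abel
        · simp }

theorem mem_blockTranslations {p : ℕ} {a : Equiv.Perm ((ZMod p × ZMod p) × ZMod 4)} :
    a ∈ blockTranslations p ↔ ∃ v, Equiv.addRight (v, 0) = a := by
  constructor
  · rintro ⟨v, rfl⟩
    exact ⟨v.toAdd, rfl⟩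
  · rintro ⟨v, rfl⟩
    exact ⟨Multiplicative.ofAdd v, rfl⟩

theorem isPGroup_blockTranslations (p : ℕ) : IsPGroup p (blockTranslations p) := by
  have : IsPGroup p (Multiplicative (ZMod p × ZMod p)) := fun g => ⟨1, by
    rw [pow_one, ← ofAdd_toAdd g, ← ofAdd_nsmul, ← Nat.cast_smul_eq_nsmul (ZMod p),
      CharP.cast_eq_zero, zero_smul]
    rfl⟩
  rw [blockTranslations, MonoidHom.range_eq_map]
  exact (this.to_subgroup ⊤).map _

theorem addRight_mem_colorAut {A C : Type*} [AddCommGroup A] (χ : A → C) (v : A) :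
    Equiv.addRight v ∈ colorAut χ := fun x y => by simp

theorem isPGroup_conj {Γ : Type*} [Group Γ] {p : ℕ} {S : Subgroup Γ} (hS : IsPGroup p S) (g : Γ) :
    IsPGroup p (S.map (MulAut.conj g).toMonoidHom) := hS.map _

theorem conj_mem_colorAut {A C : Type*} [AddCommGroup A] {χ χ' : A → C} {f : Equiv.Perm A}
    (hf : ∀ x y, χ' (f y - f x) = χ (y - x)) {a : Equiv.Perm A} (ha : a ∈ colorAut χ') :
    f⁻¹ * a * f ∈ colorAut χ := by
  intro x y
  rw [← hf]
  simp only [Equiv.Perm.mul_apply, Equiv.Perm.inv_def, Equiv.apply_symm_apply]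
  rw [ha, hf]

theorem exists_addEquiv_of_snd_eq {p : ℕ} [hp : Fact p.Prime] (hp2 : p ≠ 2) {C : Type*}
    {χ χ' : (ZMod p × ZMod p) × ZMod 4 → C}
    {f : Equiv.Perm ((ZMod p × ZMod p) × ZMod 4)} (hf : ∀ x y, χ' (f y - f x) = χ (y - x))
    (hb : ∀ x, (f x).2 = x.2) :
    ∃ φ : ((ZMod p × ZMod p) × ZMod 4) ≃+ ((ZMod p × ZMod p) × ZMod 4), ∀ x, χ' (φ x) = χ x := by
  have hfiber : ∀ v, Equiv.addRight (v, 0) ∈ fiberPerm (ZMod p × ZMod p) (ZMod 4) :=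
    fun v x => add_zero _
  have hbmem : f ∈ fiberPerm (ZMod p × ZMod p) (ZMod 4) := hb
  obtain ⟨S, hSK, hPS, hSp, hS⟩ := exists_sylow_in p
    (K := colorAut χ ⊓ fiberPerm (ZMod p × ZMod p) (ZMod 4)) (P := blockTranslations p) (by
      intro a ha
      obtain ⟨v, rfl⟩ := mem_blockTranslations.1 ha
      exact ⟨addRight_mem_colorAut _ _, hfiber v⟩) (isPGroup_blockTranslations p)
  obtain ⟨k, hk, hkS⟩ := hS ((blockTranslations p).map (MulAut.conj f⁻¹).toMonoidHom) (by
    rintro _ ⟨a, ha, rfl⟩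
    obtain ⟨v, rfl⟩ := mem_blockTranslations.1 ha
    change f⁻¹ * Equiv.addRight (v, 0) * f⁻¹⁻¹ ∈ _
    rw [inv_inv]
    exact Subgroup.mem_inf.2 ⟨conj_mem_colorAut hf (addRight_mem_colorAut _ _),
      mul_mem (mul_mem (inv_mem hbmem) (hfiber v)) hbmem⟩)
    (isPGroup_conj (isPGroup_blockTranslations p) _)
  obtain ⟨k₂, hk₂, hk₂S⟩ := hS (S.map (MulAut.conj (Equiv.addRight (0, 1))).toMonoidHom) (by
    rintro _ ⟨a, ha, rfl⟩
    change Equiv.addRight (0, 1) * a * (Equiv.addRight (0, 1))⁻¹ ∈ _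
    refine Subgroup.mem_inf.2 ⟨mul_mem (mul_mem (addRight_mem_colorAut _ _) (hSK ha).1)
      (inv_mem (addRight_mem_colorAut _ _)), fun x => ?_⟩
    change (a ((Equiv.addRight (0, 1)).symm x)).2 + 1 = x.2
    rw [(hSK ha).2]
    simp) (isPGroup_conj hSp _)
  refine exists_addEquiv_of_blockGroup (S := S) (n := k₂ * Equiv.addRight (0, 1)) (f := f * k⁻¹)
    (χ := χ) (χ' := χ') hp2 ⟨hSp, fun a ha => (hSK ha).2, fun v =>
    hPS (mem_blockTranslations.2 ⟨v, rfl⟩)⟩ (fun a ha => (hSK ha).1) ?_ ?_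
    (color_mul hf (inv_mem hk.1)) (mul_mem hbmem (inv_mem hk.2)) ?_
  · intro a ha
    have := hk₂S _ ⟨a, ha, rfl⟩
    change k₂ * (Equiv.addRight (0, 1) * a * (Equiv.addRight (0, 1))⁻¹) * k₂⁻¹ ∈ S at this
    convert this using 1
    group
  · intro x
    rw [Equiv.Perm.mul_apply, hk₂.2]
    rfl
  · intro w
    have := hkS _ ⟨_, mem_blockTranslations.2 ⟨w, rfl⟩, rfl⟩
    change k * (f⁻¹ * Equiv.addRight (w, 0) * f⁻¹⁻¹) * k⁻¹ ∈ S at this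
    convert this using 1
    group

theorem exists_word_affine (h : Equiv.Perm (ZMod 4)) :
    ∃ a b c d e t : ZMod 4, e * e = 1 ∧
      ∀ i, h.symm (h (h.symm (h (h.symm i + a) + b) + c) + d) = e * i + t := by
  revert h
  decide +kernel

theorem exists_addEquiv_of_blocks {p : ℕ} [hp : Fact p.Prime] (hp2 : p ≠ 2) {C : Type*}
    {χ χ' : (ZMod p × ZMod p) × ZMod 4 → C}
    {f : Equiv.Perm ((ZMod p × ZMod p) × ZMod 4)} (hf : ∀ x y, χ' (f y - f x) = χ (y - x))
    {h : Equiv.Perm (ZMod 4)} (hh : ∀ x, x.2 = h (f x).2) :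
    ∃ φ : ((ZMod p × ZMod p) × ZMod 4) ≃+ ((ZMod p × ZMod p) × ZMod 4), ∀ x, χ' (φ x) = χ x := by
  obtain ⟨a, b, c, d, e, t, he, hw⟩ := exists_word_affine h
  have hfs : ∀ x, (f x).2 = h.symm x.2 := fun x => by rw [hh x, Equiv.symm_apply_apply]
  let R : ZMod 4 → Equiv.Perm ((ZMod p × ZMod p) × ZMod 4) := fun i => Equiv.addRight (0, i)
  let T : ZMod 4 → Equiv.Perm ((ZMod p × ZMod p) × ZMod 4) := fun i => f⁻¹ * R i * f
  have hR : ∀ i, R i ∈ colorAut χ := fun i => addRight_mem_colorAut _ _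
  have hT : ∀ i, T i ∈ colorAut χ := fun i => conj_mem_colorAut hf (addRight_mem_colorAut _ _)
  have hR2 : ∀ i x, (R i x).2 = x.2 + i := fun i x => rfl
  have hT2 : ∀ i x, (T i x).2 = h (h.symm x.2 + i) := fun i x => by
    rw [hh (T i x)]
    simp only [T, Equiv.Perm.mul_apply, Equiv.Perm.inv_def, Equiv.apply_symm_apply]
    rw [hR2, hfs]
  let k := R d * T c * R b * T a
  have hk : k ∈ colorAut χ := mul_mem (mul_mem (mul_mem (hR _) (hT _)) (hR _)) (hT _)
  have hk2 : ∀ x, ((f * k) x).2 = e * x.2 + t := fun x => by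
    rw [← hw]
    simp only [k, Equiv.Perm.mul_apply, hfs, hR2, hT2]
  let ψ : ((ZMod p × ZMod p) × ZMod 4) ≃+ ((ZMod p × ZMod p) × ZMod 4) :=
    { toFun := fun x => (x.1, e * x.2)
      invFun := fun x => (x.1, e * x.2)
      left_inv := fun x => by simp [← mul_assoc, he]
      right_inv := fun x => by simp [← mul_assoc, he]
      map_add' := fun x y => Prod.ext rfl (mul_add _ _ _) }
  obtain ⟨φ, hφ⟩ := exists_addEquiv_of_snd_eq hp2 (χ := χ) (χ' := fun x => χ' (ψ.symm x))
    (f := ψ.toEquiv * R (-t) * (f * k)) (fun x y => by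
      simp only [Equiv.Perm.mul_apply, AddEquiv.toEquiv_eq_coe, AddEquiv.coe_toEquiv, ← map_sub,
        AddEquiv.symm_apply_apply, R, Equiv.coe_addRight, add_sub_add_right_eq_sub]
      exact color_mul hf hk x y) (fun x => by
      change e * (((f * k) x).2 + -t) = x.2
      rw [hk2, add_neg_cancel_right, ← mul_assoc, he, one_mul])
  exact ⟨φ.trans ψ.symm, hφ⟩

/-- The sets of differences preserved by a group of permutations. -/
def IsInvSet {A : Type*} [AddCommGroup A] (Γ : Subgroup (Equiv.Perm A)) (X : Set A) : Prop :=
  ∀ a ∈ Γ, ∀ x y, x - y ∈ X → a x - a y ∈ X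

/-- The orbit of a point under the stabilizer of zero. -/
def zeroOrbit {A : Type*} [AddCommGroup A] (Γ : Subgroup (Equiv.Perm A)) (x : A) : Set A :=
  {y | ∃ a ∈ Γ, a 0 = 0 ∧ a x = y}

namespace IsInvSet

variable {A : Type*} [AddCommGroup A] {Γ : Subgroup (Equiv.Perm A)} {X Y : Set A}

theorem sub_mem_iff (hX : IsInvSet Γ X) {a : Equiv.Perm A} (ha : a ∈ Γ) (x y : A) :
    a x - a y ∈ X ↔ x - y ∈ X := by
  refine ⟨fun h => ?_, hX a ha x y⟩
  have := hX _ (inv_mem ha) _ _ h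
  simpa using this

theorem apply_mem (hX : IsInvSet Γ X) {a : Equiv.Perm A} (ha : a ∈ Γ) (h0 : a 0 = 0) {x : A}
    (hx : x ∈ X) : a x ∈ X := by
  have := hX a ha x 0 (by rwa [sub_zero])
  rwa [h0, sub_zero] at this

theorem zeroOrbit_subset (hX : IsInvSet Γ X) {x : A} (hx : x ∈ X) : zeroOrbit Γ x ⊆ X := by
  rintro _ ⟨a, ha, h0, rfl⟩
  exact hX.apply_mem ha h0 hx

theorem compl (hX : IsInvSet Γ X) : IsInvSet Γ Xᶜ := fun _ ha x y h =>
  fun h' => h ((hX.sub_mem_iff ha x y).1 h')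

theorem neg (hX : IsInvSet Γ X) : IsInvSet Γ (-X) := fun a ha x y h => by
  rw [Set.mem_neg, neg_sub] at h ⊢
  exact hX a ha y x h

theorem union (hX : IsInvSet Γ X) (hY : IsInvSet Γ Y) : IsInvSet Γ (X ∪ Y) :=
  fun a ha x y h => h.imp (hX a ha x y) (hY a ha x y)

theorem quotient (hX : IsInvSet Γ X) (hY : IsInvSet Γ Y) :
    IsInvSet Γ {g | ∀ x ∈ X, x + g ∈ Y} := by
  intro a ha u v h x hx
  obtain ⟨y, hy⟩ := a.surjective (x + a u)
  have h1 : y - u ∈ X := by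
    rw [← hX.sub_mem_iff ha, hy, add_sub_cancel_right]
    exact hx
  have h2 := hY a ha y v (by
    have := h _ h1
    rwa [sub_add_sub_cancel] at this)
  rwa [hy, add_sub_assoc] at h2

theorem add (hX : IsInvSet Γ X) (hY : IsInvSet Γ Y) : IsInvSet Γ (X + Y) := by
  have := (hX.neg.quotient hY.compl).compl
  convert this using 1
  ext g
  simp only [Set.mem_add, Set.mem_compl_iff, Set.mem_ofPred_eq, Set.mem_neg, not_forall, not_not]
  constructor
  · rintro ⟨x, hx, y, hy, rfl⟩
    exact ⟨-x, by rwa [neg_neg], by rwa [neg_add_cancel_left]⟩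
  · rintro ⟨x, hx, hy⟩
    exact ⟨-x, hx, _, hy, neg_add_cancel_left _ _⟩

/-- A Frobenius argument in the group algebra shows that the multiples by a prime `q` of the
elements of an invariant set, counted modulo `q`, form invariant sets. -/
theorem multiplier [Finite A] (hX : IsInvSet Γ X) (q : ℕ) [hq : Fact q.Prime] :
    IsInvSet Γ {y | ¬ q ∣ {x ∈ X | q • x = y}.ncard} := by
  classical
  have := Fintype.ofFinite A
  have : CharP (AddMonoidAlgebra (ZMod q) A) q :=
    charP_of_injective_algebraMap' (ZMod q) q
  let Inv : AddMonoidAlgebra (ZMod q) A → Prop := fun F =>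
    ∀ a ∈ Γ, ∀ x y, F.coeff (a x - a y) = F.coeff (x - y)
  have mul : ∀ F G : AddMonoidAlgebra (ZMod q) A, Inv F → Inv G → Inv (F * G) := by
    intro F G hF hG
    have key : ∀ x y, (F * G).coeff (x - y) = ∑ z, F.coeff (x - z) * G.coeff (z - y) := by
      intro x y
      rw [AddMonoidAlgebra.coeff_mul_apply_right, Finsupp.sum_fintype _ _ (by simp)]
      refine Fintype.sum_equiv (Equiv.addRight y) _ _ fun w => ?_
      simp only [Equiv.coe_addRight, add_sub_cancel_right]
      congr 2
      abel
    intro a ha x y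
    rw [key, key, ← Equiv.sum_comp a]
    exact Finset.sum_congr rfl fun z _ => by rw [hF a ha, hG a ha]
  let F : AddMonoidAlgebra (ZMod q) A := ∑ x ∈ X.toFinset, AddMonoidAlgebra.single x 1
  have hF : Inv F := by
    intro a ha x y
    simp only [F, AddMonoidAlgebra.coeff_sum, Finsupp.coe_finsetSum, Finset.sum_apply,
      AddMonoidAlgebra.coeff_single, Finsupp.single_apply, Finset.sum_ite_eq', Set.mem_toFinset,
      hX.sub_mem_iff ha]
  have hpow : ∀ n, Inv (F ^ (n + 1)) := by
    intro n
    induction n with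
    | zero => simpa using hF
    | succ n ih =>
      rw [pow_succ]
      exact mul _ _ ih hF
  have hq' : Inv (F ^ q) := by
    have := hpow (q - 1)
    rwa [Nat.sub_add_cancel hq.out.one_le] at this
  have hcoeff : ∀ y, (F ^ q).coeff y = ({x ∈ X | q • x = y}.ncard : ZMod q) := by
    intro y
    have h1 : {x ∈ X | q • x = y} = ↑(X.toFinset.filter fun x => q • x = y) := by
      ext
      simp
    rw [h1, Set.ncard_coe_finset, sum_pow_char q]
    simp only [AddMonoidAlgebra.single_pow, one_pow, AddMonoidAlgebra.coeff_sum,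
      Finsupp.coe_finsetSum, Finset.sum_apply, AddMonoidAlgebra.coeff_single, Finsupp.single_apply,
      Finset.sum_boole]
  intro a ha x y h
  rw [Set.mem_ofPred_eq, ← CharP.cast_eq_zero_iff (ZMod q) q, ← hcoeff] at h ⊢
  rwa [hq' a ha]

theorem zeroOrbit_inv (hΓ : ∀ v, Equiv.addRight v ∈ Γ) (x : A) :
    IsInvSet Γ (zeroOrbit Γ x) := by
  rintro a ha u v ⟨b, hb, h0, hbx⟩
  refine ⟨Equiv.addRight (-a v) * a * Equiv.addRight v * b,
    mul_mem (mul_mem (mul_mem (hΓ _) ha) (hΓ _)) hb, ?_, ?_⟩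
  · simp [h0]
  · simp [hbx, sub_eq_add_neg]

end IsInvSet

theorem mem_zeroOrbit_self {A : Type*} [AddCommGroup A] (Γ : Subgroup (Equiv.Perm A)) (x : A) :
    x ∈ zeroOrbit Γ x := ⟨1, one_mem _, rfl, rfl⟩

theorem zeroOrbit_symm {A : Type*} [AddCommGroup A] {Γ : Subgroup (Equiv.Perm A)} {x y : A}
    (h : y ∈ zeroOrbit Γ x) : x ∈ zeroOrbit Γ y := by
  obtain ⟨a, ha, h0, rfl⟩ := h
  refine ⟨a⁻¹, inv_mem ha, ?_, ?_⟩
  · rw [Equiv.Perm.inv_eq_iff_eq, h0]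
  · rw [Equiv.Perm.inv_eq_iff_eq]

theorem color_eq_of_mem_zeroOrbit {A C : Type*} [AddCommGroup A] {χ : A → C} {x y : A}
    (h : y ∈ zeroOrbit (colorAut χ) x) : χ y = χ x := by
  obtain ⟨a, ha, h0, rfl⟩ := h
  have := ha 0 x
  rwa [h0, sub_zero, sub_zero] at this

theorem not_two_dvd_ncard_iff {A : Type*} {X : Set A} {a b : A} (hab : a ≠ b) :
    ¬ 2 ∣ {x ∈ X | x = a ∨ x = b}.ncard ↔ ¬ (a ∈ X ↔ b ∈ X) := by
  by_cases ha : a ∈ X <;> by_cases hb : b ∈ X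
  · have : {x ∈ X | x = a ∨ x = b} = {a, b} := by
      ext x
      simp only [Set.mem_ofPred_eq, Set.mem_insert_iff, Set.mem_singleton_iff]
      exact ⟨fun h => h.2, fun h => ⟨by rcases h with rfl | rfl <;> assumption, h⟩⟩
    rw [this, Set.ncard_pair hab]
    simp [ha, hb]
  · have : {x ∈ X | x = a ∨ x = b} = {a} := by
      ext x
      simp only [Set.mem_ofPred_eq, Set.mem_singleton_iff]
      exact ⟨fun h => h.2.resolve_right fun h' => hb (h' ▸ h.1), fun h => ⟨h ▸ ha, Or.inl h⟩⟩
    rw [this, Set.ncard_singleton]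
    simp [ha, hb]
  · have : {x ∈ X | x = a ∨ x = b} = {b} := by
      ext x
      simp only [Set.mem_ofPred_eq, Set.mem_singleton_iff]
      exact ⟨fun h => h.2.resolve_left fun h' => ha (h' ▸ h.1), fun h => ⟨h ▸ hb, Or.inr h⟩⟩
    rw [this, Set.ncard_singleton]
    simp [ha, hb]
  · have : {x ∈ X | x = a ∨ x = b} = ∅ := by
      ext x
      simp only [Set.mem_ofPred_eq, Set.mem_empty_iff_false, iff_false, not_and, not_or]
      exact fun h => ⟨fun h' => ha (h' ▸ h), fun h' => hb (h' ▸ h)⟩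
    rw [this, Set.ncard_empty]
    simp [ha, hb]

/-- The elements whose orbit under the stabilizer of zero lies in the zero block. -/
def blockCore {p : ℕ} (Γ : Subgroup (Equiv.Perm ((ZMod p × ZMod p) × ZMod 4)))
    (hΓ : ∀ v, Equiv.addRight v ∈ Γ) : AddSubgroup ((ZMod p × ZMod p) × ZMod 4) where
  carrier := {x | ∀ y ∈ zeroOrbit Γ x, y.2 = 0}
  zero_mem' := by
    rintro _ ⟨a, -, h0, rfl⟩
    rw [h0]
    rfl
  add_mem' {x y} hx hy := by
    rintro _ ⟨a, ha, h0, rfl⟩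
    have h1 := hx _ ⟨a, ha, h0, rfl⟩
    have h2 := hy _ (IsInvSet.zeroOrbit_inv hΓ y a ha (x + y) x
      (by rw [add_sub_cancel_left]; exact mem_zeroOrbit_self _ _))
    rwa [Prod.snd_sub, h1, sub_zero] at h2
  neg_mem' {x} hx := by
    rintro _ ⟨a, ha, h0, rfl⟩
    have h2 := hx _ (IsInvSet.zeroOrbit_inv hΓ x a ha 0 (-x)
      (by rw [zero_sub, neg_neg]; exact mem_zeroOrbit_self _ _))
    rwa [Prod.snd_sub, h0, Prod.snd_zero, zero_sub, neg_eq_zero] at h2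

theorem blockCore_inv {p : ℕ} {Γ : Subgroup (Equiv.Perm ((ZMod p × ZMod p) × ZMod 4))}
    (hΓ : ∀ v, Equiv.addRight v ∈ Γ) :
    IsInvSet Γ (blockCore Γ hΓ : Set ((ZMod p × ZMod p) × ZMod 4)) := by
  intro a ha x y h z hz
  have h1 := IsInvSet.zeroOrbit_inv hΓ (x - y) a ha x y (mem_zeroOrbit_self _ _)
  exact h z ((IsInvSet.zeroOrbit_inv hΓ (x - y)).zeroOrbit_subset h1 hz)

theorem subset_blockCore {p : ℕ} {Γ : Subgroup (Equiv.Perm ((ZMod p × ZMod p) × ZMod 4))}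
    (hΓ : ∀ v, Equiv.addRight v ∈ Γ) {X : Set ((ZMod p × ZMod p) × ZMod 4)}
    (hX : IsInvSet Γ X) (h : ∀ x ∈ X, x.2 = 0) : X ⊆ blockCore Γ hΓ :=
  fun _ hx y hy => h y (hX.zeroOrbit_subset hx hy)

theorem snd_eq_zero_of_mem_blockCore {p : ℕ}
    {Γ : Subgroup (Equiv.Perm ((ZMod p × ZMod p) × ZMod 4))}
    {hΓ : ∀ v, Equiv.addRight v ∈ Γ} {x : (ZMod p × ZMod p) × ZMod 4}
    (hx : x ∈ blockCore Γ hΓ) : x.2 = 0 := hx x (mem_zeroOrbit_self _ _)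

section three

variable {Γ : Subgroup (Equiv.Perm ((ZMod 3 × ZMod 3) × ZMod 4))}

theorem mem_zeroOrbit_neg_snd (hΓ : ∀ v, Equiv.addRight v ∈ Γ)
    (hM : ∀ x : (ZMod 3 × ZMod 3) × ZMod 4, x.2 ≠ 0 → ∃ y ∈ zeroOrbit Γ x, y.2 = 2)
    {x : (ZMod 3 × ZMod 3) × ZMod 4} {v : ZMod 3 × ZMod 3} {i : ZMod 4}
    (h : (v, i) ∈ zeroOrbit Γ x) : (v, -i) ∈ zeroOrbit Γ x := by
  have : Fact (Nat.Prime 7) := ⟨by norm_num⟩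
  have h7 : ∀ y : (ZMod 3 × ZMod 3) × ZMod 4, 7 • y = (y.1, -y.2) := by decide
  have h77 : ∀ y : (ZMod 3 × ZMod 3) × ZMod 4, 7 • 7 • y = y := by decide
  have key : IsInvSet Γ {y | 7 • y ∈ zeroOrbit Γ x} := by
    convert (IsInvSet.zeroOrbit_inv hΓ x).multiplier 7 using 1
    ext y
    simp only [Set.mem_ofPred_eq]
    by_cases hy : 7 • y ∈ zeroOrbit Γ x
    · have : {z ∈ zeroOrbit Γ x | 7 • z = y} = {7 • y} := by
        ext z
        simp only [Set.mem_ofPred_eq, Set.mem_singleton_iff]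
        constructor
        · rintro ⟨-, rfl⟩
          rw [h77]
        · rintro rfl
          exact ⟨hy, h77 _⟩
      rw [this, Set.ncard_singleton]
      exact iff_of_true hy (by decide)
    · have : {z ∈ zeroOrbit Γ x | 7 • z = y} = ∅ := by
        ext z
        simp only [Set.mem_ofPred_eq, Set.mem_empty_iff_false, iff_false, not_and]
        rintro hz rfl
        exact hy (by rwa [h77])
      rw [this, Set.ncard_empty]
      exact iff_of_false hy (by decide)
  obtain ⟨y, hy, hy7⟩ : ∃ y ∈ zeroOrbit Γ x, 7 • y = y := by
    by_cases hx : x.2 = 0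
    · exact ⟨x, mem_zeroOrbit_self _ _, by rw [h7]; exact Prod.ext rfl (by simp [hx])⟩
    · obtain ⟨y, hy, hy2⟩ := hM x hx
      exact ⟨y, hy, by rw [h7]; exact Prod.ext rfl (by simp only [hy2]; decide)⟩
  have hxy := key.zeroOrbit_subset (x := y) (by rw [Set.mem_ofPred_eq, hy7]; exact hy)
    (zeroOrbit_symm hy)
  have := key.zeroOrbit_subset hxy h
  rwa [Set.mem_ofPred_eq, h7] at this

theorem zeroOrbit_diff_inv (hΓ : ∀ v, Equiv.addRight v ∈ Γ)
    (hM : ∀ x : (ZMod 3 × ZMod 3) × ZMod 4, x.2 ≠ 0 → ∃ y ∈ zeroOrbit Γ x, y.2 = 2)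
    (x : (ZMod 3 × ZMod 3) × ZMod 4) :
    IsInvSet Γ {y | y.2 = 0 ∧ ¬ ((y.1, (0 : ZMod 4)) ∈ zeroOrbit Γ x ↔
      (y.1, (2 : ZMod 4)) ∈ zeroOrbit Γ x)} := by
  have h2 : ∀ (u w : ZMod 3 × ZMod 3) (i j : ZMod 4),
      2 • (u, i) = (w, j) ↔ u = -w ∧ 2 * i = j := by
    intro u w i j
    have h3 : ∀ u : ZMod 3 × ZMod 3, 2 • u = -u := by decide
    rw [Prod.smul_mk, Prod.mk.injEq, h3, neg_eq_iff_eq_neg, nsmul_eq_mul, Nat.cast_ofNat]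
  convert ((IsInvSet.zeroOrbit_inv hΓ x).multiplier 2).neg using 1
  ext ⟨w, j⟩
  have hpair : ∀ i : ZMod 4, 2 * i = -j → {y ∈ zeroOrbit Γ x | 2 • y = -(w, j)} =
      {y ∈ zeroOrbit Γ x | y = (w, i) ∨ y = (w, i + 2)} := by
    intro i hi
    ext ⟨u, k⟩
    simp only [Set.mem_ofPred_eq]
    refine and_congr_right fun _ => ?_
    change 2 • (u, k) = (-w, -j) ↔ _
    have h4 : ∀ i k : ZMod 4, 2 * k = 2 * i ↔ k = i ∨ k = i + 2 := by decide
    rw [h2, neg_neg, ← hi, h4, and_or_left]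
    exact or_congr Prod.mk_inj.symm Prod.mk_inj.symm
  have hne : ∀ i : ZMod 4, (w, i) ≠ (w, i + 2) := fun i h => by
    have h4 : ∀ i : ZMod 4, i ≠ i + 2 := by decide
    exact h4 i (congrArg Prod.snd h)
  simp only [Set.mem_neg, Set.mem_ofPred_eq]
  have hj : ∀ j : ZMod 4, j = 0 ∨ j = 2 ∨ ∀ i, 2 * i ≠ -j := by decide
  rcases hj j with rfl | rfl | hj
  · rw [hpair 0 (by decide), not_two_dvd_ncard_iff (hne 0)]
    simp
  · rw [hpair 1 (by decide), not_two_dvd_ncard_iff (hne 1)]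
    refine iff_of_false (fun h => absurd h.1 (by decide)) (not_not.2 ⟨fun h => ?_, fun h => ?_⟩)
    · exact mem_zeroOrbit_neg_snd hΓ hM h
    · exact mem_zeroOrbit_neg_snd hΓ hM h
  · have : {y ∈ zeroOrbit Γ x | 2 • y = -(w, j)} = ∅ := by
      ext ⟨u, k⟩
      simp only [Set.mem_ofPred_eq, Set.mem_empty_iff_false, iff_false, not_and]
      intro _ h
      exact hj k ((h2 u (-w) k (-j)).1 h).2
    rw [this, Set.ncard_empty]
    simp only [dvd_zero, not_true_eq_false, iff_false, not_and]
    rintro rfl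
    exact absurd (by simp) (hj 0)

end three

theorem zeroOrbit_trans {A : Type*} [AddCommGroup A] {Γ : Subgroup (Equiv.Perm A)} {x y z : A}
    (h₁ : y ∈ zeroOrbit Γ x) (h₂ : z ∈ zeroOrbit Γ y) : z ∈ zeroOrbit Γ x := by
  obtain ⟨a, ha, ha0, rfl⟩ := h₁
  obtain ⟨b, hb, hb0, rfl⟩ := h₂
  exact ⟨b * a, mul_mem hb ha, by rw [Equiv.Perm.mul_apply, ha0, hb0], rfl⟩

section three

variable {Γ : Subgroup (Equiv.Perm ((ZMod 3 × ZMod 3) × ZMod 4))}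

theorem add_two_mem_zeroOrbit (hΓ : ∀ v, Equiv.addRight v ∈ Γ)
    (hM : ∀ x : (ZMod 3 × ZMod 3) × ZMod 4, x.2 ≠ 0 → ∃ y ∈ zeroOrbit Γ x, y.2 = 2)
    {u q : (ZMod 3 × ZMod 3) × ZMod 4} (hu : u ∈ blockCore Γ hΓ)
    (hq : q ∈ zeroOrbit Γ (0, 2)) : u + (0, 2) ∈ zeroOrbit Γ (u + q) := by
  have hadd : ∀ x : (ZMod 3 × ZMod 3) × ZMod 4, x.2 = 0 → x + (0, 2) = (x.1, 2) :=
    fun x hx => Prod.ext (add_zero _) (by rw [Prod.snd_add, hx, zero_add])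
  obtain ⟨a, ha, ha0, rfl⟩ := hq
  obtain ⟨y, hy⟩ := a.surjective (u + a (0, 2))
  have hyX : y ∈ zeroOrbit Γ (u + a (0, 2)) := by
    rw [← hy]
    exact zeroOrbit_symm ⟨a, ha, ha0, rfl⟩
  have hyu : y - (0, 2) ∈ zeroOrbit Γ u := by
    rw [← (IsInvSet.zeroOrbit_inv hΓ u).sub_mem_iff ha, hy, add_sub_cancel_right]
    exact mem_zeroOrbit_self _ _
  have hu' : y - (0, 2) ∈ blockCore Γ hΓ := (blockCore_inv hΓ).zeroOrbit_subset hu hyu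
  have hout : ∀ x ∈ blockCore Γ hΓ, x ∉ zeroOrbit Γ (u + a (0, 2)) := by
    intro x hx hxX
    have h1 := (blockCore_inv hΓ).zeroOrbit_subset hx (zeroOrbit_trans (zeroOrbit_symm hxX) hyX)
    have h2 := sub_mem h1 hu'
    rw [sub_sub_cancel] at h2
    exact absurd (snd_eq_zero_of_mem_blockCore h2) (by decide)
  have hD := (zeroOrbit_diff_inv hΓ hM (u + a (0, 2))).zeroOrbit_subset (x := y - (0, 2)) (by
    have h0 := snd_eq_zero_of_mem_blockCore hu'
    refine ⟨h0, fun h => hout _ hu' ?_⟩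
    have h1 := hadd _ h0
    rw [sub_add_cancel] at h1
    rw [← h1] at h
    have h2 := h.2 hyX
    rw [← h0] at h2
    exact h2) (zeroOrbit_symm hyu)
  rw [hadd _ hD.1]
  by_contra h
  refine hD.2 (iff_of_false ?_ h)
  have h0 := hout u hu
  rw [← hD.1]
  exact h0

theorem exists_linking_subgroup (hΓ : ∀ v, Equiv.addRight v ∈ Γ)
    (hM : ∀ x : (ZMod 3 × ZMod 3) × ZMod 4, x.2 ≠ 0 → ∀ j, j ≠ 0 → ∃ y ∈ zeroOrbit Γ x, y.2 = j) :
    ∃ Q : AddSubgroup ((ZMod 3 × ZMod 3) × ZMod 4),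
      IsInvSet Γ (Q : Set ((ZMod 3 × ZMod 3) × ZMod 4)) ∧ (0, 1) ∈ Q ∧
      ∀ x, ∀ q ∈ Q, x ∉ blockCore Γ hΓ → x + q ∉ blockCore Γ hΓ → x + q ∈ zeroOrbit Γ x := by
  have hM2 : ∀ x : (ZMod 3 × ZMod 3) × ZMod 4, x.2 ≠ 0 → ∃ y ∈ zeroOrbit Γ x, y.2 = 2 :=
    fun x hx => hM x hx 2 (by decide)
  set z : (ZMod 3 × ZMod 3) × ZMod 4 := (0, 2) with hz
  set U := blockCore Γ hΓ with hU
  have hUinv : IsInvSet Γ (U : Set ((ZMod 3 × ZMod 3) × ZMod 4)) := blockCore_inv hΓ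
  have hzz : -z = z := by decide
  have hzU : z ∉ U := fun h => absurd (snd_eq_zero_of_mem_blockCore h) (by decide)
  set Z := zeroOrbit Γ z with hZ
  have hZinv : IsInvSet Γ Z := IsInvSet.zeroOrbit_inv hΓ z
  have hzZ : z ∈ Z := mem_zeroOrbit_self _ _
  have hZneg : ∀ y ∈ Z, -y ∈ Z := fun y hy =>
    hZinv.neg.zeroOrbit_subset (x := z) (by rw [Set.mem_neg, hzz]; exact hzZ) hy
  have hZU : ∀ y ∈ Z, y ∉ U := fun y hy hyU =>
    hzU (hUinv.zeroOrbit_subset hyU (zeroOrbit_symm hy))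
  have hval : ∀ i : ZMod 4, i = 0 ∨ i = 2 ∨ (i + 2 = -i) := by decide
  have hD : ∀ x, {y : (ZMod 3 × ZMod 3) × ZMod 4 | y.2 = 0 ∧
      ¬ ((y.1, (0 : ZMod 4)) ∈ zeroOrbit Γ x ↔ (y.1, (2 : ZMod 4)) ∈ zeroOrbit Γ x)} ⊆ U :=
    fun x => subset_blockCore hΓ (zeroOrbit_diff_inv hΓ hM2 x) fun y hy => hy.1
  set R : Set ((ZMod 3 × ZMod 3) × ZMod 4) := {r | r ∈ U ∧ r + z ∈ Z} with hR
  have hRinv : IsInvSet Γ R := by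
    convert zeroOrbit_diff_inv hΓ hM2 z using 1
    ext ⟨v, i⟩
    constructor
    · rintro ⟨h1, h2⟩
      obtain rfl : i = 0 := snd_eq_zero_of_mem_blockCore h1
      refine ⟨rfl, fun h => hZU _ (h.2 ?_) h1⟩
      convert h2 using 1
      simp [hz]
    · intro h
      obtain ⟨rfl, h2⟩ := id h
      refine ⟨hD z h, ?_⟩
      have h3 : (v, (0 : ZMod 4)) + z = (v, 2) := by simp [hz]
      rw [h3]
      by_contra h4
      exact h2 (iff_of_false (fun h5 => hZU _ h5 (hD z h)) h4)
  have hRZ : ∀ w ∈ Z, ∀ r ∈ R, r + w ∈ Z := fun w hw =>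
    (hRinv.quotient hZinv).zeroOrbit_subset (x := z) (fun r hr => hr.2) hw
  have hZZ : ∀ g ∈ Z, ∀ w ∈ Z, w + g ∈ Z ∪ R := fun g hg =>
    (hZinv.quotient (hZinv.union hRinv)).zeroOrbit_subset (x := z) (by
      rintro ⟨v, i⟩ hw
      rcases hval i with rfl | rfl | hi
      · have h3 : (v, (0 : ZMod 4)) + z = (v, 2) := by simp [hz]
        left
        rw [h3]
        by_contra h4
        exact hZU _ hw (hD z ⟨rfl, fun h => h4 (h.1 hw)⟩)
      · have h3 : (v, (2 : ZMod 4)) + z = (v, 0) :=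
          Prod.ext (add_zero _) (show (2 : ZMod 4) + 2 = 0 by decide)
        rw [h3]
        by_cases h4 : (v, (0 : ZMod 4)) ∈ Z
        · exact Or.inl h4
        · refine Or.inr ⟨hD z ⟨rfl, fun h => h4 (h.2 hw)⟩, ?_⟩
          convert hw using 1
          simp [hz]
      · left
        have h3 : (v, i) + z = (v, -i) := Prod.ext (add_zero _) hi
        rw [h3]
        exact mem_zeroOrbit_neg_snd hΓ hM2 hw) hg
  let Q : AddSubgroup ((ZMod 3 × ZMod 3) × ZMod 4) :=
    { carrier := Z ∪ R
      zero_mem' := Or.inr ⟨zero_mem _, by rwa [zero_add]⟩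
      add_mem' := by
        rintro x y (hx | hx) (hy | hy)
        · exact hZZ _ hy _ hx
        · left
          rw [add_comm]
          exact hRZ _ hx _ hy
        · exact Or.inl (hRZ _ hy _ hx)
        · right
          refine ⟨add_mem hx.1 hy.1, ?_⟩
          rw [add_assoc]
          exact hRZ _ hy.2 _ hx
      neg_mem' := by
        rintro x (hx | hx)
        · exact Or.inl (hZneg _ hx)
        · refine Or.inr ⟨neg_mem hx.1, ?_⟩
          rw [← hzz, ← neg_add]
          exact hZneg _ hx.2 }
  have hQ : ∀ {q}, q ∈ Q ↔ q ∈ Z ∨ q ∈ R := Iff.rfl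
  have hQinv : IsInvSet Γ (Q : Set ((ZMod 3 × ZMod 3) × ZMod 4)) := hZinv.union hRinv
  refine ⟨Q, hQinv, ?_, ?_⟩
  · obtain ⟨⟨v, i⟩, hy, hi⟩ := hM z (by decide) 1 (by decide)
    simp only at hi
    subst hi
    have h1 : (-v, (1 : ZMod 4)) ∈ Z := by
      have h2 : (-v, -(1 : ZMod 4)) ∈ Z := hZneg _ hy
      have h3 := mem_zeroOrbit_neg_snd hΓ hM2 h2
      rwa [neg_neg] at h3
    have h2 : (v, (1 : ZMod 4)) + ((v, 1) - (-v, 1)) ∈ Q :=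
      add_mem (hQ.2 (Or.inl hy)) (sub_mem (hQ.2 (Or.inl hy)) (hQ.2 (Or.inl h1)))
    have h3 : ∀ v : ZMod 3 × ZMod 3, v + (v - -v) = 0 := by decide
    convert h2 using 1
    exact Prod.ext (h3 v).symm (by simp)
  · intro x q hq hx hxq
    by_cases hxUQ : x ∈ (U : Set ((ZMod 3 × ZMod 3) × ZMod 4)) + (Q : Set _)
    · obtain ⟨u, hu, q₁, hq₁, rfl⟩ := hxUQ
      have key : ∀ q' ∈ Q, u + q' ∉ U → u + z ∈ zeroOrbit Γ (u + q') := fun q' hq' h =>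
        add_two_mem_zeroOrbit hΓ hM2 hu (hq'.resolve_right fun h' => h (add_mem hu h'.1))
      rw [add_assoc] at hxq ⊢
      exact zeroOrbit_trans (key q₁ hq₁ hx) (zeroOrbit_symm (key _ (add_mem hq₁ hq) hxq))
    · have hX : IsInvSet Γ (zeroOrbit Γ x) := IsInvSet.zeroOrbit_inv hΓ x
      have hper : Z ⊆ {g | ∀ w ∈ zeroOrbit Γ x, w + g ∈ zeroOrbit Γ x} :=
        (hX.quotient hX).zeroOrbit_subset (by
          rintro ⟨v, i⟩ hw
          rcases hval i with rfl | rfl | hi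
          · have h3 : (v, (0 : ZMod 4)) + z = (v, 2) := by simp [hz]
            rw [h3]
            by_contra h4
            exact hx (hUinv.zeroOrbit_subset (hD x ⟨rfl, fun h => h4 (h.1 hw)⟩)
              (zeroOrbit_symm hw))
          · have h3 : (v, (2 : ZMod 4)) + z = (v, 0) :=
              Prod.ext (add_zero _) (show (2 : ZMod 4) + 2 = 0 by decide)
            rw [h3]
            by_contra h4
            have h5 : (v, (0 : ZMod 4)) ∈ U := hD x ⟨rfl, fun h => h4 (h.2 hw)⟩
            refine hxUQ ((hUinv.add hQinv).zeroOrbit_subset ?_ (zeroOrbit_symm hw))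
            exact ⟨_, h5, z, hQ.2 (Or.inl hzZ), by simp [hz]⟩
          · have h3 : (v, i) + z = (v, -i) := Prod.ext (add_zero _) hi
            rw [h3]
            exact mem_zeroOrbit_neg_snd hΓ hM2 hw)
      have hself := mem_zeroOrbit_self Γ x
      rcases hq with hq | hq
      · exact hper hq x hself
      · have h1 := hper (hZneg _ hzZ) _ (hper hq.2 x hself)
        rwa [← add_assoc, add_neg_cancel_right] at h1

end three

theorem exists_perm_of_card_fiber_eq {X Y : Type*} [Finite X] {g₁ g₂ : X → Y}
    (h : ∀ y, Nat.card {x // g₁ x = y} = Nat.card {x // g₂ x = y}) :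
    ∃ b : Equiv.Perm X, ∀ x, g₁ (b x) = g₂ x := by
  have e : ∀ y, {x // g₂ x = y} ≃ {x // g₁ x = y} := fun y =>
    Classical.choice ((Finite.card_eq).1 (h y).symm)
  refine ⟨(Equiv.sigmaFiberEquiv g₂).symm.trans ((Equiv.sigmaCongrRight e).trans
    (Equiv.sigmaFiberEquiv g₁)), fun x => ?_⟩
  exact (e (g₂ x) ⟨x, rfl⟩).2

theorem four_mul_card_fiber {X K : Type*} [Finite X] {h : X → K} {κ : X → ZMod 4}
    (t : Equiv.Perm X) (ht : ∀ x, h (t x) = h x) (hκ : ∀ x, κ (t x) = κ x + 1) (k : K)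
    (j : ZMod 4) :
    4 * Nat.card {x // (h x, κ x) = (k, j)} = Nat.card {x // h x = k} := by
  classical
  have := Fintype.ofFinite X
  have step : ∀ i, Nat.card {x // (h x, κ x) = (k, i)} =
      Nat.card {x // (h x, κ x) = (k, i + 1)} := fun i =>
    Nat.card_congr (t.subtypeEquiv fun x => by
      rw [Prod.mk.injEq, Prod.mk.injEq, ht, hκ, add_left_inj])
  have all : ∀ i, Nat.card {x // (h x, κ x) = (k, i)} =
      Nat.card {x // (h x, κ x) = (k, j)} := by
    have h1 : ∀ n : ℕ, Nat.card {x // (h x, κ x) = (k, j)} =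
        Nat.card {x // (h x, κ x) = (k, j + n)} := by
      intro n
      induction n with
      | zero => simp
      | succ n ih => rw [ih, step, Nat.cast_succ, add_assoc]
    intro i
    rw [h1 (i - j).val, ZMod.natCast_zmod_val, add_sub_cancel]
  have e : {x // h x = k} ≃ Σ i, {x // (h x, κ x) = (k, i)} :=
    { toFun := fun x => ⟨κ x, x.1, by rw [x.2]⟩
      invFun := fun x => ⟨x.2.1, (Prod.mk_inj.1 x.2.2).1⟩
      left_inv := fun x => rfl
      right_inv := by
        rintro ⟨i, x, hx⟩
        obtain ⟨rfl, rfl⟩ := Prod.mk_inj.1 hx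
        rfl }
  rw [Nat.card_congr e, Nat.card_sigma, Finset.sum_congr rfl fun i _ => all i, Finset.sum_const,
    Finset.card_univ, ZMod.card, smul_eq_mul]

theorem exists_transported_subgroup {A C : Type*} [AddCommGroup A] {χ χ' : A → C}
    {f : Equiv.Perm A} (hf : ∀ x y, χ' (f y - f x) = χ (y - x)) {H : AddSubgroup A}
    (hH : IsInvSet (colorAut χ) (H : Set A)) :
    ∃ H' : AddSubgroup A, (∀ x y, f x - f y ∈ H' ↔ x - y ∈ H) ∧ Nat.card H' = Nat.card H := by
  have key : ∀ x y, f⁻¹ (f 0 + (f x - f y)) ∈ H ↔ x - y ∈ H := by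
    intro x y
    have h1 := hH.sub_mem_iff
      (conj_mem_colorAut hf (addRight_mem_colorAut χ' (f 0 - f y))) x y
    simp only [Equiv.Perm.mul_apply, Equiv.coe_addRight, add_sub_cancel, Equiv.Perm.inv_def,
      Equiv.symm_apply_apply, sub_zero, SetLike.mem_coe] at h1
    rw [← h1, Equiv.Perm.inv_def, add_sub_left_comm]
  have key' : ∀ x, f⁻¹ (f 0 + (x - f 0)) ∈ H ↔ f⁻¹ x ∈ H := fun x => by
    rw [add_sub_cancel]
  let H' : AddSubgroup A :=
    { carrier := {w | f⁻¹ (f 0 + w) ∈ H}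
      zero_mem' := by
        change f⁻¹ (f 0 + 0) ∈ H
        rw [add_zero, Equiv.Perm.inv_def, Equiv.symm_apply_apply]
        exact zero_mem _
      add_mem' := by
        intro v w hv hw
        change f⁻¹ (f 0 + (v + w)) ∈ H
        have h1 := key (f⁻¹ (f 0 + (v + w))) (f⁻¹ (f 0 + v))
        simp only [Equiv.Perm.inv_def, Equiv.apply_symm_apply] at h1
        rw [show f 0 + (v + w) - (f 0 + v) = w by abel] at h1
        have h2 := add_mem (h1.1 hw) hv
        rwa [Equiv.Perm.inv_def, sub_add_cancel] at h2
      neg_mem' := by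
        intro v hv
        change f⁻¹ (f 0 + -v) ∈ H
        have h1 := key 0 (f⁻¹ (f 0 + -v))
        simp only [Equiv.Perm.inv_def, Equiv.apply_symm_apply] at h1
        rw [show f 0 - (f 0 + -v) = v by abel, zero_sub, neg_mem_iff] at h1
        exact h1.1 hv }
  refine ⟨H', key, (Nat.card_congr ((f.trans (Equiv.subRight (f 0))).subtypeEquiv fun x => ?_)).symm⟩
  have := key x 0
  rw [sub_zero] at this
  exact this.symm

theorem addOrderOf_zero_one : addOrderOf ((0, 1) : (ZMod 3 × ZMod 3) × ZMod 4) = 4 := by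
  have : Fact (Nat.Prime 2) := ⟨Nat.prime_two⟩
  exact addOrderOf_eq_prime_pow (p := 2) (n := 1) (by decide +revert) (by decide +revert)

theorem exists_addEquiv_of_linked {C : Type*} {χ χ' : (ZMod 3 × ZMod 3) × ZMod 4 → C}
    {f : Equiv.Perm ((ZMod 3 × ZMod 3) × ZMod 4)} (hf : ∀ x y, χ' (f y - f x) = χ (y - x))
    (hM : ∀ x : (ZMod 3 × ZMod 3) × ZMod 4, x.2 ≠ 0 →
      ∀ j, j ≠ 0 → ∃ y ∈ zeroOrbit (colorAut χ) x, y.2 = j) :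
    ∃ φ : ((ZMod 3 × ZMod 3) × ZMod 4) ≃+ ((ZMod 3 × ZMod 3) × ZMod 4),
      ∀ x, χ' (φ x) = χ x := by
  have hΓ : ∀ v, Equiv.addRight v ∈ colorAut χ := fun v => addRight_mem_colorAut χ v
  obtain ⟨Q, hQinv, hcQ, hQ⟩ := exists_linking_subgroup hΓ hM
  set U := blockCore (colorAut χ) hΓ
  have hUinv : IsInvSet (colorAut χ) (U : Set ((ZMod 3 × ZMod 3) × ZMod 4)) := blockCore_inv hΓ
  have hU2 : ∀ u ∈ U, u.2 = 0 := fun u hu => snd_eq_zero_of_mem_blockCore hu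
  let H := U ⊔ Q
  have hHinv : IsInvSet (colorAut χ) (H : Set ((ZMod 3 × ZMod 3) × ZMod 4)) := by
    rw [AddSubgroup.add_normal]
    exact hUinv.add hQinv
  obtain ⟨U', hU', hUcard⟩ := exists_transported_subgroup hf hUinv
  obtain ⟨H', hH', hHcard⟩ := exists_transported_subgroup hf hHinv
  have hU'2 : ∀ u ∈ U', u.2 = 0 := by
    intro u hu
    have h1 : Nat.card U ∣ 9 := by
      have := AddSubgroup.card_dvd_of_injective
        ((AddMonoidHom.fst (ZMod 3 × ZMod 3) (ZMod 4)).comp U.subtype) (by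
          rintro ⟨u, hu⟩ ⟨v, hv⟩ h
          exact Subtype.ext (Prod.ext h ((hU2 u hu).trans (hU2 v hv).symm)))
      simpa using this
    have h2 : 9 • u = 0 := by
      rw [← addOrderOf_dvd_iff_nsmul_eq_zero]
      exact ((U'.addOrderOf_dvd_natCard hu).trans hUcard.dvd).trans h1
    have h3 : ∀ i : ZMod 4, 9 • i = 0 → i = 0 := by decide
    exact h3 _ (congrArg Prod.snd h2)
  have hcH' : ((0, 1) : (ZMod 3 × ZMod 3) × ZMod 4) ∈ H' := by
    have h2 : 4 ∣ Nat.card H' := by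
      rw [hHcard]
      exact addOrderOf_zero_one.symm.dvd.trans
        (H.addOrderOf_dvd_natCard (AddSubgroup.mem_sup_right hcQ))
    obtain ⟨m, hm⟩ := h2
    have h3 := H'.card_mul_index
    have h4 : Nat.card ((ZMod 3 × ZMod 3) × ZMod 4) = 36 := by simp
    rw [hm, h4] at h3
    have h5 : m * H'.index = 9 := by linarith
    have h6 := nsmul_mem (H'.nsmul_index_mem (0, 1)) m
    rw [← mul_nsmul', h5] at h6
    exact h6
  have mkU : ∀ x y : (ZMod 3 × ZMod 3) × ZMod 4,
      (QuotientAddGroup.leftRel U) x y ↔ y - x ∈ U := fun x y => by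
    rw [QuotientAddGroup.leftRel_apply, neg_add_eq_sub]
  let X := ((ZMod 3 × ZMod 3) × ZMod 4) ⧸ U
  let h : X → ((ZMod 3 × ZMod 3) × ZMod 4) ⧸ H :=
    QuotientAddGroup.map U H (AddMonoidHom.id _) le_sup_left
  let κ₁ : X → ZMod 4 := QuotientAddGroup.lift U (AddMonoidHom.snd _ _) hU2
  let κ₂ : X → ZMod 4 := Quotient.lift (fun x => (f x).2) fun x y hxy => by
    have h1 := hU'2 _ ((hU' y x).2 ((mkU x y).1 hxy))
    exact (sub_eq_zero.1 h1).symm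
  have lift : ∀ t ∈ colorAut χ, ∃ t' : Equiv.Perm X, ∀ x : (ZMod 3 × ZMod 3) × ZMod 4,
      t' (x : X) = (t x : X) := fun t ht =>
    ⟨Quotient.congr t fun x y => by rw [mkU, mkU]; exact (hUinv.sub_mem_iff ht y x).symm,
      fun x => rfl⟩
  obtain ⟨t₁, ht₁⟩ := lift _ (hΓ (0, 1))
  obtain ⟨t₂, ht₂⟩ := lift _ (conj_mem_colorAut hf (addRight_mem_colorAut χ' (0, 1)))
  have hcard₁ := four_mul_card_fiber (h := h) (κ := κ₁) t₁ (by
    intro x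
    induction x using QuotientAddGroup.induction_on with
    | H x =>
      rw [ht₁]
      change ((_ : (ZMod 3 × ZMod 3) × ZMod 4) : _ ⧸ H) = (x : _ ⧸ H)
      rw [QuotientAddGroup.eq_iff_sub_mem]
      change x + (0, 1) - x ∈ H
      rw [add_sub_cancel_left]
      exact AddSubgroup.mem_sup_right hcQ) (by
    intro x
    induction x using QuotientAddGroup.induction_on with
    | H x =>
      rw [ht₁]
      rfl)
  have hcard₂ := four_mul_card_fiber (h := h) (κ := κ₂) t₂ (by
    intro x
    induction x using QuotientAddGroup.induction_on with
    | H x =>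
      rw [ht₂]
      change ((_ : (ZMod 3 × ZMod 3) × ZMod 4) : _ ⧸ H) = (x : _ ⧸ H)
      rw [QuotientAddGroup.eq_iff_sub_mem, ← hH']
      change f (f.symm (f x + (0, 1))) - f x ∈ H'
      rwa [Equiv.apply_symm_apply, add_sub_cancel_left]) (by
    intro x
    induction x using QuotientAddGroup.induction_on with
    | H x =>
      rw [ht₂]
      change (f _).2 = (f x).2 + 1
      simp only [Equiv.Perm.mul_apply, Equiv.Perm.inv_def, Equiv.apply_symm_apply,
        Equiv.coe_addRight, Prod.snd_add])
  obtain ⟨b, hb⟩ := exists_perm_of_card_fiber_eq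
    (g₁ := fun x => (h x, κ₁ x)) (g₂ := fun x => (h x, κ₂ x)) (by
      rintro ⟨k, j⟩
      have := (hcard₁ k j).trans (hcard₂ k j).symm
      omega)
  have hd : ∀ x : X, ∃ q ∈ Q, b x = x + (q : X) := by
    intro x
    obtain ⟨y, hy⟩ := QuotientAddGroup.mk_surjective (b x)
    obtain ⟨x, rfl⟩ := QuotientAddGroup.mk_surjective x
    have h1 : h (b x) = h x := (Prod.mk_inj.1 (hb x)).1
    rw [← hy] at h1 ⊢
    change (y : _ ⧸ H) = (x : _ ⧸ H) at h1
    rw [QuotientAddGroup.eq_iff_sub_mem, AddSubgroup.mem_sup] at h1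
    obtain ⟨u, hu, q, hq, huq⟩ := h1
    refine ⟨q, hq, ?_⟩
    rw [← QuotientAddGroup.mk_add, QuotientAddGroup.eq_iff_sub_mem, ← sub_sub, ← huq,
      add_sub_cancel_right]
    exact hu
  choose d hdQ hdb using hd
  have ha : ∀ x : (ZMod 3 × ZMod 3) × ZMod 4, ((x + d x : (ZMod 3 × ZMod 3) × ZMod 4) : X) = b x :=
    fun x => by rw [QuotientAddGroup.mk_add, ← hdb]
  let a : Equiv.Perm ((ZMod 3 × ZMod 3) × ZMod 4) :=
    Equiv.ofBijective (fun x => x + d x) (Finite.injective_iff_bijective.1 (by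
      intro x y hxy
      simp only at hxy
      have h1 : (x : X) = y := b.injective (by rw [← ha, ← ha, hxy])
      rw [h1] at hxy
      exact add_right_cancel hxy))
  have haΓ : a ∈ colorAut χ := by
    intro x y
    change χ (y + d y - (x + d x)) = _
    by_cases hxy : (y : X) = x
    · rw [hxy, add_sub_add_right_eq_sub]
    · have h1 : y + d y - (x + d x) = y - x + (d y - d x) := by abel
      have h2 : y + d y - (x + d x) ∉ U := by
        rw [← QuotientAddGroup.eq_iff_sub_mem, ha, ha]
        exact fun h => hxy (b.injective h)
      rw [h1] at h2 ⊢
      exact color_eq_of_mem_zeroOrbit (hQ _ _ (sub_mem (hdQ _) (hdQ _))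
        (fun h => hxy (QuotientAddGroup.eq_iff_sub_mem.2 h)) h2)
  have ha2 : ∀ x, (a x).2 = (f x).2 := fun x => by
    have h1 : κ₁ (b x) = κ₂ x := (Prod.mk_inj.1 (hb x)).2
    rw [← ha] at h1
    exact h1
  have : Fact (Nat.Prime 3) := ⟨Nat.prime_three⟩
  refine exists_addEquiv_of_snd_eq (by norm_num) (color_mul hf (inv_mem haΓ)) fun x => ?_
  rw [Equiv.Perm.mul_apply, ← ha2, Equiv.Perm.inv_def, Equiv.apply_symm_apply]

theorem prime_pow_le_four {p m : ℕ} (hp : p.Prime) (hp2 : p ≠ 2) (h1 : 1 < p ^ m)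
    (h4 : p ^ m ≤ 4) : p = 3 ∧ p ^ m = 3 := by
  have h3 : 3 ≤ p := by
    have := hp.two_le
    omega
  match m with
  | 0 => simp at h1
  | 1 =>
    rw [pow_one] at h1 h4 ⊢
    have : p ≠ 4 := by
      rintro rfl
      revert hp
      norm_num
    omega
  | m + 2 =>
    have : 3 ^ 2 ≤ p ^ (m + 2) := (Nat.pow_le_pow_left h3 2).trans
      (Nat.pow_le_pow_right (by omega) (by omega))
    omega

theorem exists_addEquiv_of_color_eq {p : ℕ} [hp : Fact p.Prime] (hp2 : p ≠ 2) {C : Type*}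
    {χ χ' : (ZMod p × ZMod p) × ZMod 4 → C}
    {f : Equiv.Perm ((ZMod p × ZMod p) × ZMod 4)} (hf : ∀ x y, χ' (f y - f x) = χ (y - x)) :
    ∃ φ : ((ZMod p × ZMod p) × ZMod 4) ≃+ ((ZMod p × ZMod p) × ZMod 4), ∀ x, χ' (φ x) = χ x := by
  obtain ⟨S, hSK, hPS, hSp, hS⟩ := exists_sylow_in p (K := colorAut χ)
    (P := blockTranslations p) (by
      intro a ha
      obtain ⟨v, rfl⟩ := mem_blockTranslations.1 ha
      exact addRight_mem_colorAut _ _) (isPGroup_blockTranslations p)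
  have htr : ∀ x y : (ZMod p × ZMod p) × ZMod 4, x.2 = y.2 → ∃ s ∈ S, s x = y := by
    intro x y h
    exact ⟨_, hPS (mem_blockTranslations.2 ⟨y.1 - x.1, rfl⟩),
      Prod.ext (add_sub_cancel _ _) ((add_zero _).trans h)⟩
  by_cases hfix : ∀ s ∈ S, ∀ x, (s x).2 = x.2
  · obtain ⟨k, hk, hkS⟩ := hS ((blockTranslations p).map (MulAut.conj f⁻¹).toMonoidHom) (by
      rintro _ ⟨a, ha, rfl⟩
      obtain ⟨v, rfl⟩ := mem_blockTranslations.1 ha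
      change f⁻¹ * Equiv.addRight (v, 0) * f⁻¹⁻¹ ∈ _
      rw [inv_inv]
      exact conj_mem_colorAut hf (addRight_mem_colorAut _ _))
      (isPGroup_conj (isPGroup_blockTranslations p) _)
    let g := f * k⁻¹
    have hgS : ∀ v, g⁻¹ * Equiv.addRight (v, 0) * g ∈ S := by
      intro v
      have := hkS _ ⟨_, mem_blockTranslations.2 ⟨v, rfl⟩, rfl⟩
      change k * (f⁻¹ * Equiv.addRight (v, 0) * f⁻¹⁻¹) * k⁻¹ ∈ S at this
      convert this using 1
      simp only [g]
      group
    let h : ZMod 4 → ZMod 4 := fun j => (g.symm (0, j)).2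
    have hh : ∀ x, x.2 = h (g x).2 := by
      intro x
      rw [← hfix _ (hgS (-(g x).1)) x]
      change (g.symm (g x + (-(g x).1, 0))).2 = _
      congr 2
      exact Prod.ext (add_neg_cancel _) (add_zero _)
    have hbij : Function.Bijective h := Finite.surjective_iff_bijective.1 fun i =>
      ⟨(g (0, i)).2, (hh (0, i)).symm⟩
    exact exists_addEquiv_of_blocks hp2 (color_mul hf (inv_mem hk))
      (h := Equiv.ofBijective h hbij) hh
  · push Not at hfix
    obtain ⟨s, hs, x, hx⟩ := hfix
    let J : Set (ZMod 4) := {j | ∃ s ∈ S, s x = (0, j)}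
    have hJ : ∀ y, y.2 ∈ J ↔ ∃ s ∈ S, s x = y := by
      intro y
      constructor
      · rintro ⟨s, hs, hsx⟩
        obtain ⟨t, ht, hty⟩ := htr (s x) y (by rw [hsx])
        exact ⟨t * s, mul_mem ht hs, hty⟩
      · rintro ⟨s, hs, rfl⟩
        obtain ⟨t, ht, hty⟩ := htr (s x) (0, (s x).2) rfl
        exact ⟨t * s, mul_mem ht hs, hty⟩
    have hcard : ∃ m, J.ncard = p ^ m := by
      obtain ⟨n, hn⟩ := hSp.card_orbit x
      have e : MulAction.orbit S x ≃ (ZMod p × ZMod p) × J :=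
        { toFun := fun y => (y.1.1, ⟨y.1.2, (hJ _).2 (by
            obtain ⟨t, ht⟩ := y.2
            exact ⟨t, t.2, ht⟩)⟩)
          invFun := fun y => ⟨(y.1, y.2), by
            obtain ⟨t, ht, h⟩ := (hJ (y.1, y.2)).1 y.2.2
            exact ⟨⟨t, ht⟩, h⟩⟩
          left_inv := fun y => rfl
          right_inv := fun y => rfl }
      rw [Nat.card_congr e, Nat.card_prod, Nat.card_coe_set_eq] at hn
      obtain ⟨m, -, hm⟩ := (Nat.dvd_prime_pow hp.out).1 (Dvd.intro_left _ hn)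
      exact ⟨m, hm⟩
    obtain ⟨m, hm⟩ := hcard
    have hlow : 1 < J.ncard := (Set.one_lt_ncard_iff (Set.toFinite _)).2
      ⟨(s x).2, x.2, (hJ _).2 ⟨s, hs, rfl⟩, (hJ _).2 ⟨1, one_mem _, rfl⟩, hx⟩
    have htot : J.ncard + Jᶜ.ncard = 4 := by
      rw [Set.ncard_add_ncard_compl, Nat.card_zmod]
    rw [hm] at hlow htot
    obtain ⟨rfl, h3⟩ := prime_pow_le_four hp.out hp2 hlow (by omega)
    obtain ⟨i, hi⟩ := Set.ncard_eq_one.1 (show Jᶜ.ncard = 1 by omega)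
    have hJi : ∀ j, j ≠ i ↔ j ∈ J := fun j => by
      rw [← not_iff_not, not_not, ← Set.mem_compl_iff, hi, Set.mem_singleton_iff]
    have hSi : ∀ t ∈ S, (t (0, i)).2 = i := by
      intro t ht
      by_contra h
      obtain ⟨r, hr, hrx⟩ := (hJ _).1 ((hJi _).1 h)
      refine (hJi i).2 ((hJ (0, i)).2 ⟨t⁻¹ * r, mul_mem (inv_mem ht) hr, ?_⟩) rfl
      rw [Equiv.Perm.mul_apply, hrx, Equiv.Perm.inv_def, Equiv.symm_apply_apply]
    refine exists_addEquiv_of_linked hf fun y hy j hj => ?_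
    obtain ⟨r₁, hr₁, h₁⟩ := (hJ (y + (0, i))).1 ((hJi _).1 (by
      rw [Prod.snd_add]
      simpa using hy))
    obtain ⟨r₂, hr₂, h₂⟩ := (hJ (0, j + i)).1 ((hJi _).1 (by simpa using hj))
    have hr : r₂ * r₁⁻¹ ∈ S := mul_mem hr₂ (inv_mem hr₁)
    refine ⟨_, ⟨Equiv.addRight (-(r₂ * r₁⁻¹) (0, i)) * (r₂ * r₁⁻¹) * Equiv.addRight (0, i),
      mul_mem (mul_mem (addRight_mem_colorAut _ _) (hSK hr)) (addRight_mem_colorAut _ _),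
      ?_, rfl⟩, ?_⟩
    · change (r₂ * r₁⁻¹) (0 + (0, i)) + -(r₂ * r₁⁻¹) (0, i) = 0
      rw [zero_add, add_neg_cancel]
    · have h₃ : (r₂ * r₁⁻¹) (y + (0, i)) = (0, j + i) := by
        rw [← h₁, Equiv.Perm.mul_apply, Equiv.Perm.inv_def, Equiv.symm_apply_apply, h₂]
      change ((r₂ * r₁⁻¹) (y + (0, i)) + -(r₂ * r₁⁻¹) (0, i)).2 = j
      rw [h₃, Prod.snd_add, Prod.snd_neg, hSi _ hr, add_neg_cancel_right]

theorem isDCIGroup_of_ne_two {p : ℕ} (hp : p.Prime) (hp2 : p ≠ 2) :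
    IsDCIGroup (Multiplicative (ZMod 4) × Multiplicative (ZMod p) × Multiplicative (ZMod p)) := by
  have : Fact p.Prime := ⟨hp⟩
  rintro S T ⟨f, hf⟩
  let e : (Multiplicative (ZMod 4) × Multiplicative (ZMod p) × Multiplicative (ZMod p)) ≃
      (ZMod p × ZMod p) × ZMod 4 :=
    { toFun := fun g => ((g.2.1.toAdd, g.2.2.toAdd), g.1.toAdd)
      invFun := fun x => (Multiplicative.ofAdd x.2, Multiplicative.ofAdd x.1.1,
        Multiplicative.ofAdd x.1.2)
      left_inv := fun g => rfl
      right_inv := fun x => rfl }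
  have hsub : ∀ x y, e.symm (y - x) = e.symm y * (e.symm x)⁻¹ := fun x y => by
    simp only [sub_eq_add_neg]
    rfl
  obtain ⟨φ, hφ⟩ := exists_addEquiv_of_color_eq hp2 (χ := fun x => e.symm x ∈ S)
    (χ' := fun x => e.symm x ∈ T) (f := (e.symm.trans f).trans e) (fun x y => propext (by
      simp only [hsub, Equiv.trans_apply, Equiv.symm_apply_apply]
      exact (hf _ _).symm))
  have hφ' : ∀ g, e.symm (φ (e g)) ∈ T ↔ g ∈ S := fun g => by
    have := (hφ (e g)).to_iff
    rwa [Equiv.symm_apply_apply] at this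
  refine ⟨{ toEquiv := (e.trans φ.toEquiv).trans e.symm, map_mul' := fun g h => ?_ }, ?_⟩
  · change e.symm (φ (e g + e h)) = _
    rw [map_add]
    rfl
  · ext t
    constructor
    · rintro ⟨g, hg, rfl⟩
      exact (hφ' g).2 hg
    · intro ht
      have hinv : e.symm (φ (e (e.symm (φ.symm (e t))))) = t := by simp
      exact ⟨_, (hφ' _).1 (by rwa [hinv]), hinv⟩

theorem not_isDCIGroup_two :
    ¬ IsDCIGroup (Multiplicative (ZMod 4) × Multiplicative (ZMod 2) × Multiplicative (ZMod 2)) := by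
  intro h
  let f : Multiplicative (ZMod 4) × Multiplicative (ZMod 2) × Multiplicative (ZMod 2) →
      Multiplicative (ZMod 4) × Multiplicative (ZMod 2) × Multiplicative (ZMod 2) := fun g =>
    (Multiplicative.ofAdd ((g.1.toAdd.val % 2 + 2 * g.2.1.toAdd.val : ℕ) : ZMod 4),
      Multiplicative.ofAdd ((g.1.toAdd.val / 2 : ℕ) : ZMod 2), g.2.2)
  have hff : ∀ g, f (f g) = g := by decide
  obtain ⟨φ, hφ⟩ := h {(Multiplicative.ofAdd 2, 1, 1)} {(1, Multiplicative.ofAdd 1, 1)}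
    ⟨⟨f, f, hff, hff⟩, by
      simp only [Set.mem_singleton_iff, Equiv.coe_fn_mk]
      decide +kernel⟩
  rw [Set.image_singleton, Set.singleton_eq_singleton_iff] at hφ
  have h1 : ((Multiplicative.ofAdd 2, 1, 1) :
      Multiplicative (ZMod 4) × Multiplicative (ZMod 2) × Multiplicative (ZMod 2)) =
      (Multiplicative.ofAdd 1, 1, 1) ^ 2 := by decide
  have h2 : ∀ g : Multiplicative (ZMod 4) × Multiplicative (ZMod 2) × Multiplicative (ZMod 2),
      g ^ 2 ≠ (1, Multiplicative.ofAdd 1, 1) := by decide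
  rw [h1, map_pow] at hφ
  exact h2 _ hφ

/-- Let `p` be a prime. Then the group `C₄ × C_p × C_p` is a
DCI-group if and only if `p ≠ 2`. -/
theorem stmt0 (p : ℕ) (hp : p.Prime) :
    IsDCIGroup (Multiplicative (ZMod 4) × Multiplicative (ZMod p) × Multiplicative (ZMod p)) ↔ p ≠ 2 := by
  constructor
  · rintro h rfl
    exact not_isDCIGroup_two h
  · exact isDCIGroup_of_ne_two hp

end Paper
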